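/- arXiv:math-ph/0502043 — 5 statements merged into one kernel-verified Lean document; each statement's English description precedes it below -/
import Mathlib

section
/- For all natural numbers N and k, ∫_{Sp(2N)} det(I − g)^k dg = ( (N+k)! / (N! · k!) ) · ∏_{i=1}^{k} ( (k+2N+i)! · i! ) / ( (2i+2N)! · (2i−1)! ). -/
open MeasureTheory Matrix Finset

noncomputable section

instance matrixMeasurableSpace {m n R : Type*} [MeasurableSpace R] :
    MeasurableSpace (Matrix m n R) :=
  MeasurableSpace.pi

/-- The standard symplectic form matrix `J = [[0, I_N], [-I_N, 0]]`, as a `2N × 2N`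
complex matrix (rows and columns indexed by `Fin N ⊕ Fin N`). -/
def Jmat (N : ℕ) : Matrix (Fin N ⊕ Fin N) (Fin N ⊕ Fin N) ℂ :=
  Matrix.fromBlocks 0 1 (-1) 0

/-- The compact symplectic group `Sp(2N)`: the group of `2N × 2N` complex unitary
matrices `g` satisfying `g * J * gᵀ = J`. -/
def SpGroup (N : ℕ) : Subgroup (Matrix.unitaryGroup (Fin N ⊕ Fin N) ℂ) where
  carrier := {g | (g : Matrix (Fin N ⊕ Fin N) (Fin N ⊕ Fin N) ℂ) * Jmat N
      * (g : Matrix (Fin N ⊕ Fin N) (Fin N ⊕ Fin N) ℂ)ᵀ = Jmat N}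
  one_mem' := by simp
  mul_mem' := by
    intro a b ha hb
    simp only [Set.mem_setOf_eq] at *
    have h : ((a * b : Matrix.unitaryGroup (Fin N ⊕ Fin N) ℂ) :
        Matrix (Fin N ⊕ Fin N) (Fin N ⊕ Fin N) ℂ)
        = (a : Matrix (Fin N ⊕ Fin N) (Fin N ⊕ Fin N) ℂ)
          * (b : Matrix (Fin N ⊕ Fin N) (Fin N ⊕ Fin N) ℂ) := rfl
    set A := (a : Matrix (Fin N ⊕ Fin N) (Fin N ⊕ Fin N) ℂ)
    set B := (b : Matrix (Fin N ⊕ Fin N) (Fin N ⊕ Fin N) ℂ)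
    rw [h, Matrix.transpose_mul]
    calc (A * B) * Jmat N * (Bᵀ * Aᵀ)
        = A * ((B * Jmat N * Bᵀ) * Aᵀ) := by simp only [mul_assoc]
      _ = A * (Jmat N * Aᵀ) := by rw [hb]
      _ = A * Jmat N * Aᵀ := by rw [mul_assoc]
      _ = Jmat N := ha
  inv_mem' := by
    intro a ha
    simp only [Set.mem_setOf_eq] at *
    set A := (a : Matrix (Fin N ⊕ Fin N) (Fin N ⊕ Fin N) ℂ) with hA
    have h : ((a⁻¹ : Matrix.unitaryGroup (Fin N ⊕ Fin N) ℂ) :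
        Matrix (Fin N ⊕ Fin N) (Fin N ⊕ Fin N) ℂ) = star A := rfl
    rw [h]
    have h1 : star A * A = 1 := Matrix.UnitaryGroup.star_mul_self a
    calc star A * Jmat N * (star A)ᵀ
        = star A * (A * Jmat N * Aᵀ) * (star A)ᵀ := by rw [ha]
      _ = (star A * A) * (Jmat N * (Aᵀ * (star A)ᵀ)) := by simp only [mul_assoc]
      _ = (star A * A) * (Jmat N * (star A * A)ᵀ) := by rw [Matrix.transpose_mul]
      _ = Jmat N := by rw [h1]; simp

/-- The complex matrix underlying an element of `Sp(2N)`. -/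
def spMat {N : ℕ} (g : SpGroup N) : Matrix (Fin N ⊕ Fin N) (Fin N ⊕ Fin N) ℂ :=
  ((g : Matrix.unitaryGroup (Fin N ⊕ Fin N) ℂ) : Matrix (Fin N ⊕ Fin N) (Fin N ⊕ Fin N) ℂ)

namespace SpGroup

theorem mul_conjTranspose_self {N : ℕ} (g : SpGroup N) : spMat g * (spMat g)ᴴ = 1 :=
  Matrix.mem_unitaryGroup_iff.mp g.1.2

theorem conjTranspose_mul_self {N : ℕ} (g : SpGroup N) : (spMat g)ᴴ * spMat g = 1 :=
  Matrix.mem_unitaryGroup_iff'.mp g.1.2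

theorem mul_Jmat_mul_transpose {N : ℕ} (g : SpGroup N) :
    spMat g * Jmat N * (spMat g)ᵀ = Jmat N := g.2

@[simp]
theorem spMat_mul {N : ℕ} (g h : SpGroup N) : spMat (g * h) = spMat g * spMat h := rfl

/-- The element of `Sp(2N)` given by a unitary matrix that preserves the symplectic form. -/
def ofMatrix {N : ℕ} (M : Matrix (Fin N ⊕ Fin N) (Fin N ⊕ Fin N) ℂ) (hM : M * Mᴴ = 1)
    (hJ : M * Jmat N * Mᵀ = Jmat N) : SpGroup N :=
  ⟨⟨M, Matrix.mem_unitaryGroup_iff.mpr hM⟩, hJ⟩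

@[simp]
theorem spMat_ofMatrix {N : ℕ} (M : Matrix (Fin N ⊕ Fin N) (Fin N ⊕ Fin N) ℂ) (hM : M * Mᴴ = 1)
    (hJ : M * Jmat N * Mᵀ = Jmat N) : spMat (ofMatrix M hM hJ) = M := rfl

theorem continuous_spMat {N : ℕ} : Continuous (spMat (N := N)) :=
  continuous_subtype_val.comp continuous_subtype_val

theorem isClosedEmbedding_spMat {N : ℕ} : Topology.IsClosedEmbedding (spMat (N := N)) := by
  refine ⟨Topology.IsEmbedding.subtypeVal.comp Topology.IsEmbedding.subtypeVal, ?_⟩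
  have : Set.range (spMat (N := N)) = {M | M * Mᴴ = 1 ∧ M * Jmat N * Mᵀ = Jmat N} := by
    ext M
    constructor
    · rintro ⟨g, rfl⟩
      exact ⟨mul_conjTranspose_self g, mul_Jmat_mul_transpose g⟩
    · rintro ⟨hM, hJ⟩
      exact ⟨ofMatrix M hM hJ, rfl⟩
  rw [this]
  apply IsClosed.inter
  · exact isClosed_eq (by fun_prop) continuous_const
  · exact isClosed_eq (by fun_prop) continuous_const

instance secondCountableTopology {N : ℕ} : SecondCountableTopology (SpGroup N) := by
  have : SecondCountableTopology (Matrix (Fin N ⊕ Fin N) (Fin N ⊕ Fin N) ℂ) :=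
    inferInstanceAs (SecondCountableTopology (Fin N ⊕ Fin N → Fin N ⊕ Fin N → ℂ))
  exact isClosedEmbedding_spMat.isEmbedding.secondCountableTopology

instance borelSpace {N : ℕ} : BorelSpace (SpGroup N) := by
  have : BorelSpace (Matrix (Fin N ⊕ Fin N) (Fin N ⊕ Fin N) ℂ) :=
    inferInstanceAs (BorelSpace (Fin N ⊕ Fin N → Fin N ⊕ Fin N → ℂ))
  have : BorelSpace (Matrix.unitaryGroup (Fin N ⊕ Fin N) ℂ) := Subtype.borelSpace _
  exact Subtype.borelSpace _

instance compactSpace {N : ℕ} : CompactSpace (SpGroup N) := by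
  have hK : IsCompact (Set.pi Set.univ fun _ => Set.pi Set.univ fun _ => Metric.closedBall 0 1 :
      Set (Fin N ⊕ Fin N → Fin N ⊕ Fin N → ℂ)) :=
    isCompact_univ_pi fun _ => isCompact_univ_pi fun _ => isCompact_closedBall 0 1
  refine ⟨(isClosedEmbedding_spMat.isCompact_preimage hK).of_isClosed_subset isClosed_univ ?_⟩
  intro g _ i _ j _
  simpa using! entry_norm_bound_of_unitary g.1.2 i j

theorem integrable_of_continuous {N : ℕ} {μ : Measure (SpGroup N)} [IsFiniteMeasure μ]
    {f : SpGroup N → ℂ} (hf : Continuous f) : Integrable f μ :=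
  hf.integrable_of_hasCompactSupport (HasCompactSupport.of_compactSpace f)

/-- Integration against the Haar measure is invariant under averaging over a compact family of
left translations. -/
theorem integral_integral_mul_left {M N : ℕ} {μ : Measure (SpGroup N)} [μ.IsMulLeftInvariant]
    [IsProbabilityMeasure μ] {ν : Measure (SpGroup M)} [IsProbabilityMeasure ν]
    {f : SpGroup N → ℂ} (hf : Continuous f) {φ : SpGroup M → SpGroup N} (hφ : Continuous φ) :
    ∫ g, ∫ h, f (φ h * g) ∂ν ∂μ = ∫ g, f g ∂μ := by
  rw [integral_integral_swap]
  · simp [integral_mul_left_eq_self]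
  · apply Continuous.integrable_of_hasCompactSupport
    · simp only [Function.uncurry_def]; fun_prop
    · exact HasCompactSupport.of_compactSpace _

end SpGroup

section Blocks

variable {m n : Type*} [Fintype m] [Fintype n] [DecidableEq m]

/-- If the block matrix `(a, b; c, d)` preserves a block diagonal form, then so does the matrix
`d + c (1 - a)⁻¹ b` obtained by closing a feedback loop through the first block. -/
theorem feedback_mul_mul {R : Type*} [CommRing R]
    {a a' x r r' : Matrix m m R} {b b' : Matrix m n R} {c c' : Matrix n m R}
    {d d' y : Matrix n n R} (hr : r * (1 - a) = 1) (hr' : (1 - a') * r' = 1)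
    (h : fromBlocks a b c d * fromBlocks x 0 0 y * fromBlocks a' b' c' d' = fromBlocks x 0 0 y) :
    (d + c * r * b) * y * (d' + c' * r' * b') = y := by
  simp only [fromBlocks_multiply, Matrix.mul_zero, zero_add, add_zero, fromBlocks_inj] at h
  obtain ⟨h₁₁, h₁₂, h₂₁, h₂₂⟩ := h
  have hra : r * a = r - 1 := by rw [← hr, mul_sub, mul_one, sub_sub_cancel]
  have har : a' * r' = r' - 1 := by rw [← hr', sub_mul, one_mul, sub_sub_cancel]
  have e₂₂ : d * y * d' = y - c * x * b' := eq_sub_of_add_eq' h₂₂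
  have e₂₁ : d * y * c' = - (c * x * a') := eq_neg_of_add_eq_zero_right h₂₁
  have e₁₂ : b * y * d' = - (a * x * b') := eq_neg_of_add_eq_zero_right h₁₂
  have e₁₁ : b * y * c' = x - a * x * a' := eq_sub_of_add_eq' h₁₁
  calc (d + c * r * b) * y * (d' + c' * r' * b')
      = d * y * d' + (d * y * c') * r' * b' + c * r * (b * y * d')
        + c * r * (b * y * c') * r' * b' := by
        simp only [Matrix.add_mul, Matrix.mul_add, Matrix.mul_assoc]; abel
    _ = y - c * x * b' - c * x * (a' * r') * b' - c * (r * a) * x * b'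
        + c * r * x * r' * b' - c * (r * a) * x * (a' * r') * b' := by
        rw [e₂₂, e₂₁, e₁₂, e₁₁]
        simp only [Matrix.sub_mul, Matrix.mul_sub, Matrix.mul_assoc, Matrix.neg_mul,
          Matrix.mul_neg]
        abel
    _ = y := by
        rw [hra, har]
        simp only [Matrix.sub_mul, Matrix.mul_sub, Matrix.mul_assoc, Matrix.mul_one]
        abel

variable [DecidableEq n]

theorem det_one_sub_fromBlocks_mul {R : Type*} [CommRing R]
    {a r : Matrix m m R} {b : Matrix m n R} {c : Matrix n m R}
    {d : Matrix n n R} (hr : r * (1 - a) = 1) (h : Matrix n n R) :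
    (1 - fromBlocks a b c d * fromBlocks 1 0 0 h).det
      = (1 - a).det * (1 - (d + c * r * b) * h).det := by
  have hr' : (1 - a) * r = 1 := mul_eq_one_comm.mp hr
  let _ : Invertible (1 - a) := ⟨r, hr, hr'⟩
  have hinv : ⅟(1 - a) = r := rfl
  rw [fromBlocks_multiply, ← fromBlocks_one, sub_eq_add_neg, fromBlocks_neg, fromBlocks_add]
  simp only [Matrix.mul_one, Matrix.mul_zero, zero_add, add_zero, ← sub_eq_add_neg]
  rw [det_fromBlocks₁₁, hinv]
  congr 2
  simp only [Matrix.add_mul, Matrix.mul_assoc, zero_sub, Matrix.neg_mul, Matrix.mul_neg]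
  abel

theorem det_one_sub_fromBlocks_mul_eq_zero {a : Matrix m m ℂ} {b : Matrix m n ℂ}
    {c : Matrix n m ℂ} {d : Matrix n n ℂ} (hac : aᴴ * a + cᴴ * c = 1) (ha : (1 - a).det = 0)
    (h : Matrix n n ℂ) : (1 - fromBlocks a b c d * fromBlocks 1 0 0 h).det = 0 := by
  obtain ⟨x, hx, hax⟩ := Matrix.exists_mulVec_eq_zero_iff.mpr ha
  have hax : a *ᵥ x = x := by
    rw [Matrix.sub_mulVec, Matrix.one_mulVec, sub_eq_zero] at hax
    exact hax.symm
  have hcx : c *ᵥ x = 0 := by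
    have h1 : star x ⬝ᵥ ((aᴴ * a + cᴴ * c) *ᵥ x) = star x ⬝ᵥ x := by rw [hac, one_mulVec]
    rw [add_mulVec, dotProduct_add, ← mulVec_mulVec, ← mulVec_mulVec, dotProduct_mulVec,
      dotProduct_mulVec (star x) cᴴ, ← star_mulVec, ← star_mulVec, hax] at h1
    open ComplexOrder in
    exact dotProduct_star_self_eq_zero.mp (by simpa using h1)
  rw [← Matrix.exists_mulVec_eq_zero_iff]
  refine ⟨Sum.elim x 0, fun h0 => hx ?_, ?_⟩
  · ext i
    exact congrFun h0 (Sum.inl i)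
  · rw [sub_mulVec, one_mulVec, ← mulVec_mulVec, fromBlocks_mulVec, fromBlocks_mulVec]
    simp [hax, hcx, Sum.elim_comp_inl, Sum.elim_comp_inr]

end Blocks

namespace SpGroup

/-- The bijection of `Fin (N + 1)` with a distinguished point and a copy of `Fin N`. -/
def splitIndex (N : ℕ) : Fin 1 ⊕ Fin N ≃ Fin (N + 1) :=
  (Equiv.sumComm _ _).trans finSumFinEquiv

/-- The splitting of the coordinates of `ℂ^(2N+2)` into a symplectic plane and a copy of
`ℂ^(2N)`. -/
def blockIndex (N : ℕ) :
    (Fin 1 ⊕ Fin 1) ⊕ (Fin N ⊕ Fin N) ≃ Fin (N + 1) ⊕ Fin (N + 1) :=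
  (Equiv.sumSumSumComm _ _ _ _).trans (Equiv.sumCongr (splitIndex N) (splitIndex N))

theorem Jmat_submatrix (N : ℕ) :
    (Jmat (N + 1)).submatrix (blockIndex N) (blockIndex N)
      = fromBlocks (Jmat 1) 0 0 (Jmat N) := by
  ext i j
  rcases i with (i | i) | (i | i) <;> rcases j with (j | j) | (j | j) <;>
    simp [Jmat, blockIndex, Matrix.one_apply]

/-- `Sp(2N)` as the subgroup of `Sp(2N+2)` fixing a symplectic plane pointwise. -/
def embed {N : ℕ} (h : SpGroup N) : SpGroup (N + 1) :=
  ofMatrix ((fromBlocks (1 : Matrix (Fin 1 ⊕ Fin 1) (Fin 1 ⊕ Fin 1) ℂ) 0 0 (spMat h)).submatrix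
      (blockIndex N).symm (blockIndex N).symm)
    (by
      rw [conjTranspose_submatrix, submatrix_mul_equiv, fromBlocks_conjTranspose,
        fromBlocks_multiply]
      simp [mul_conjTranspose_self])
    (by
      have hJ : Jmat (N + 1) = (fromBlocks (Jmat 1) 0 0 (Jmat N)).submatrix
          (blockIndex N).symm (blockIndex N).symm := by simp [← Jmat_submatrix]
      rw [hJ, transpose_submatrix, submatrix_mul_equiv, submatrix_mul_equiv, fromBlocks_transpose,
        fromBlocks_multiply, fromBlocks_multiply]
      simp [mul_Jmat_mul_transpose])

theorem spMat_embed_submatrix {N : ℕ} (h : SpGroup N) :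
    (spMat (embed h)).submatrix (blockIndex N) (blockIndex N) = fromBlocks 1 0 0 (spMat h) := by
  simp [embed]

theorem continuous_embed {N : ℕ} : Continuous (embed (N := N)) := by
  rw [isClosedEmbedding_spMat.continuous_iff]
  have := continuous_spMat (N := N)
  simp only [Function.comp_def, embed, spMat_ofMatrix]
  fun_prop

/-- The restriction of an element of `Sp(2N+2)` to the distinguished symplectic plane. -/
def corner {N : ℕ} (g : SpGroup (N + 1)) : Matrix (Fin 1 ⊕ Fin 1) (Fin 1 ⊕ Fin 1) ℂ :=
  ((spMat g).submatrix (blockIndex N) (blockIndex N)).toBlocks₁₁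

theorem det_one_sub_mul_embed {N : ℕ} (g : SpGroup (N + 1)) (h : SpGroup N) :
    (1 - spMat (g * embed h)).det
      = (1 - (spMat g).submatrix (blockIndex N) (blockIndex N)
          * fromBlocks 1 0 0 (spMat h)).det := by
  rw [← spMat_embed_submatrix, submatrix_mul_equiv, ← spMat_mul,
    ← submatrix_one_equiv (blockIndex N), ← Pi.sub_apply, ← Pi.sub_apply, ← submatrix_sub,
    det_submatrix_equiv_self]

theorem exists_feedback {N : ℕ} (g : SpGroup (N + 1)) (hg : (1 - corner g).det ≠ 0) :
    ∃ s : SpGroup N, ∀ h : SpGroup N,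
      (1 - spMat (g * embed h)).det = (1 - corner g).det * (1 - spMat (s * h)).det := by
  set G := (spMat g).submatrix (blockIndex N) (blockIndex N) with hG
  set a := G.toBlocks₁₁ with ha
  set b := G.toBlocks₁₂
  set c := G.toBlocks₂₁
  set d := G.toBlocks₂₂
  have hblocks : G = fromBlocks a b c d := (fromBlocks_toBlocks G).symm
  have hr : (1 - a)⁻¹ * (1 - a) = 1 := nonsing_inv_mul _ (isUnit_iff_ne_zero.mpr hg)
  have hU : G * 1 * Gᴴ = 1 := by
    rw [mul_one, hG, conjTranspose_submatrix, submatrix_mul_equiv, mul_conjTranspose_self,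
      submatrix_one_equiv]
  have hJ : G * fromBlocks (Jmat 1) 0 0 (Jmat N) * Gᵀ = fromBlocks (Jmat 1) 0 0 (Jmat N) := by
    rw [hG, ← Jmat_submatrix, transpose_submatrix, submatrix_mul_equiv, submatrix_mul_equiv,
      mul_Jmat_mul_transpose]
  rw [hblocks] at hU hJ
  refine ⟨ofMatrix (d + c * (1 - a)⁻¹ * b) ?_ ?_, fun h => ?_⟩
  · rw [← fromBlocks_one, fromBlocks_conjTranspose] at hU
    have := feedback_mul_mul (r' := ((1 - a)⁻¹)ᴴ) hr
      (by simpa using congrArg conjTranspose hr) hU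
    rw [mul_one] at this
    simpa [Matrix.mul_assoc] using this
  · rw [fromBlocks_transpose] at hJ
    have := feedback_mul_mul (r' := ((1 - a)⁻¹)ᵀ) hr
      (by simpa using congrArg transpose hr) hJ
    simpa [Matrix.mul_assoc] using this
  · rw [det_one_sub_mul_embed, ← hG, hblocks, det_one_sub_fromBlocks_mul hr]
    rfl

theorem det_one_sub_mul_embed_eq_zero {N : ℕ} (g : SpGroup (N + 1)) (hg : (1 - corner g).det = 0)
    (h : SpGroup N) : (1 - spMat (g * embed h)).det = 0 := by
  set G := (spMat g).submatrix (blockIndex N) (blockIndex N) with hG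
  have hblocks : G = fromBlocks G.toBlocks₁₁ G.toBlocks₁₂ G.toBlocks₂₁ G.toBlocks₂₂ :=
    (fromBlocks_toBlocks G).symm
  have hU : Gᴴ * G = 1 := by
    rw [hG, conjTranspose_submatrix, submatrix_mul_equiv, conjTranspose_mul_self,
      submatrix_one_equiv]
  rw [hblocks, fromBlocks_conjTranspose, fromBlocks_multiply, ← fromBlocks_one,
    fromBlocks_inj] at hU
  rw [det_one_sub_mul_embed, ← hG, hblocks, det_one_sub_fromBlocks_mul_eq_zero hU.1 hg]

/-- The `k`-th moment over `Sp(2N+2)` is the `k`-th moment over `Sp(2N)` times the moment of the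
`2 × 2` corner. -/
theorem integral_det_one_sub_pow_succ {N : ℕ} (k : ℕ) (μ : Measure (SpGroup (N + 1)))
    [μ.IsMulLeftInvariant] [IsProbabilityMeasure μ] (ν : Measure (SpGroup N))
    [ν.IsMulLeftInvariant] [IsProbabilityMeasure ν] :
    ∫ g, (1 - spMat g).det ^ k ∂μ
      = (∫ g, (1 - corner g).det ^ k ∂μ) * ∫ h, (1 - spMat h).det ^ k ∂ν := by
  have := continuous_spMat (N := N + 1)
  rw [← integral_integral_mul_left (ν := ν) (by fun_prop) continuous_embed,
    ← integral_mul_const]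
  congr 1 with g
  have hcomm (h : SpGroup N) :
      (1 - spMat (embed h * g)).det = (1 - spMat (g * embed h)).det := by
    rw [spMat_mul, spMat_mul, det_one_sub_mul_comm]
  simp only [hcomm]
  by_cases hg : (1 - corner g).det = 0
  · rcases Nat.eq_zero_or_pos k with rfl | hk
    · simp
    · simp only [det_one_sub_mul_embed_eq_zero g hg, hg, zero_pow hk.ne', integral_zero, zero_mul]
  · obtain ⟨s, hs⟩ := exists_feedback g hg
    simp only [hs, mul_pow]
    rw [integral_const_mul, integral_mul_left_eq_self fun h => (1 - spMat h).det ^ k]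

open ComplexConjugate

/-- The quaternionic homothety `1 + X (q - 1) Xᴴ` of ratio `q` along the quaternionic line spanned
by the columns of `X`. -/
def homothety {N : ℕ} (X : Matrix (Fin N ⊕ Fin N) (Fin 1 ⊕ Fin 1) ℂ) (q : SpGroup 1)
    (hX : Xᴴ * X = 1) (hJ : Xᴴ * Jmat N = Jmat 1 * Xᵀ) : SpGroup N :=
  ofMatrix (1 + X * (spMat q - 1) * Xᴴ)
    (by
      have h := mul_conjTranspose_self q
      have e : (1 + X * (spMat q - 1) * Xᴴ) * (1 + X * (spMat q - 1) * Xᴴ)ᴴ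
          = 1 + X * ((spMat q - 1) + ((spMat q)ᴴ - 1)
            + (spMat q - 1) * (Xᴴ * X) * ((spMat q)ᴴ - 1)) * Xᴴ := by
        simp only [conjTranspose_add, conjTranspose_mul, conjTranspose_sub, conjTranspose_one,
          conjTranspose_conjTranspose, Matrix.mul_add, Matrix.add_mul, Matrix.mul_one,
          Matrix.one_mul, Matrix.mul_assoc]
        abel
      have e' : (spMat q - 1) + ((spMat q)ᴴ - 1) + (spMat q - 1) * 1 * ((spMat q)ᴴ - 1)
          = spMat q * (spMat q)ᴴ - 1 := by noncomm_ring
      rw [e, hX, e', h, sub_self, Matrix.mul_zero, Matrix.zero_mul, add_zero])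
    (by
      have h := mul_Jmat_mul_transpose q
      have hJ' : Jmat N * Xᴴᵀ = X * Jmat 1 := by
        have := congrArg transpose hJ
        have hneg (n : ℕ) : (Jmat n)ᵀ = -Jmat n := by
          simp [Jmat, fromBlocks_transpose, fromBlocks_neg]
        simpa [transpose_mul, hneg] using this
      have e : (1 + X * (spMat q - 1) * Xᴴ) * Jmat N * (1 + X * (spMat q - 1) * Xᴴ)ᵀ
          = Jmat N + X * ((spMat q - 1) * Jmat 1 + Jmat 1 * ((spMat q)ᵀ - 1)
            + (spMat q - 1) * ((Xᴴ * X) * Jmat 1) * ((spMat q)ᵀ - 1)) * Xᵀ := by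
        have h1 : (1 + X * (spMat q - 1) * Xᴴ) * Jmat N * (1 + X * (spMat q - 1) * Xᴴ)ᵀ
          = Jmat N + X * (spMat q - 1) * (Xᴴ * Jmat N) + (Jmat N * Xᴴᵀ) * ((spMat q)ᵀ - 1) * Xᵀ
            + X * (spMat q - 1) * Xᴴ * (Jmat N * Xᴴᵀ) * ((spMat q)ᵀ - 1) * Xᵀ := by
          simp only [transpose_add, transpose_mul, transpose_sub, transpose_one,
            Matrix.mul_add, Matrix.add_mul, Matrix.mul_one,
            Matrix.one_mul, Matrix.mul_assoc]
          abel
        rw [h1, hJ', hJ]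
        simp only [Matrix.mul_add, Matrix.add_mul, Matrix.mul_assoc]
        abel
      have e' : (spMat q - 1) * Jmat 1 + Jmat 1 * ((spMat q)ᵀ - 1)
          + (spMat q - 1) * (1 * Jmat 1) * ((spMat q)ᵀ - 1)
          = spMat q * Jmat 1 * (spMat q)ᵀ - Jmat 1 := by noncomm_ring
      rw [e, hX, e', h, sub_self, Matrix.mul_zero, Matrix.zero_mul, add_zero])

/-- The element of `Sp(2)` given by the unit quaternion `α + β j`. -/
def unitQuaternion (α β : ℂ) (h : α * conj α + β * conj β = 1) : SpGroup 1 :=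
  ofMatrix (fromBlocks (of fun _ _ => α) (of fun _ _ => -conj β) (of fun _ _ => β)
      (of fun _ _ => conj α))
    (by
      rw [fromBlocks_conjTranspose, fromBlocks_multiply, ← fromBlocks_one, fromBlocks_inj]
      refine ⟨?_, ?_, ?_, ?_⟩ <;> ext i j <;>
        simp [Matrix.mul_apply, Matrix.one_apply, Subsingleton.elim i j] <;>
        first | ring1 | linear_combination h)
    (by
      rw [Jmat, fromBlocks_transpose, fromBlocks_multiply, fromBlocks_multiply, fromBlocks_inj]
      refine ⟨?_, ?_, ?_, ?_⟩ <;> ext i j <;>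
        simp [Matrix.mul_apply, Matrix.one_apply, Subsingleton.elim i j] <;>
        first | ring1 | linear_combination h | linear_combination -h)

/-- Multiplication of a real vector of `ℂ^(2N)` by the quaternion `j`. -/
def mulJ {N : ℕ} (x : Fin N ⊕ Fin N → ℝ) : Fin N ⊕ Fin N → ℝ :=
  Sum.elim (fun i => -x (Sum.inr i)) (fun i => x (Sum.inl i))

theorem exists_homothety {N : ℕ} (x : Fin N ⊕ Fin N → ℝ) (hx : ∑ i, x i ^ 2 = 1) (α β : ℂ)
    (h : α * conj α + β * conj β = 1) :
    ∃ g : SpGroup N, ∀ (v : Fin N ⊕ Fin N → ℂ) i,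
      (spMat g *ᵥ v) i = v i
        + x i * ((α - 1) * (∑ j, x j * v j) - conj β * ∑ j, mulJ x j * v j)
        + mulJ x i * (β * (∑ j, x j * v j) + (conj α - 1) * ∑ j, mulJ x j * v j) := by
  have hx' : ∑ i, (x i : ℂ) ^ 2 = 1 := by exact_mod_cast hx
  rw [Fintype.sum_sum_type] at hx'
  refine ⟨homothety (of fun i => Sum.elim (fun _ => (x i : ℂ)) (fun _ => (mulJ x i : ℂ)))
    (unitQuaternion α β h) ?_ ?_, fun v i => ?_⟩
  · ext i j
    rcases i with i | i <;> rcases j with j | j <;>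
      simp [Matrix.mul_apply, mulJ, Matrix.one_apply, Subsingleton.elim i j, ← pow_two, hx',
        mul_comm]
    simpa [add_comm] using hx'
  · ext i j
    rcases i with i | i <;> rcases j with j | j <;>
      simp [Matrix.mul_apply, mulJ, Jmat, Matrix.one_apply, Subsingleton.elim i 0]
  · rw [homothety, spMat_ofMatrix, add_mulVec, one_mulVec, ← mulVec_mulVec, ← mulVec_mulVec]
    simp only [Pi.add_apply, mulVec, dotProduct, unitQuaternion, spMat_ofMatrix]
    simp [Matrix.one_apply]
    ring

theorem mulJ_single {N : ℕ} (p : Fin N) :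
    mulJ (Pi.single (Sum.inl p) (1 : ℝ)) = Pi.single (Sum.inr p) 1 := by
  ext i
  rcases i with i | i <;> simp [mulJ, Pi.single_apply]

theorem exists_mul_apply_plane {N : ℕ} (p : Fin N) (α β : ℂ)
    (h : α * conj α + β * conj β = 1) :
    ∃ t : SpGroup N, ∀ (g : SpGroup N) (j : Fin N ⊕ Fin N),
      spMat (t * g) (Sum.inl p) j = α * spMat g (Sum.inl p) j - conj β * spMat g (Sum.inr p) j ∧
      spMat (t * g) (Sum.inr p) j = β * spMat g (Sum.inl p) j + conj α * spMat g (Sum.inr p) j ∧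
      ∀ i, i ≠ Sum.inl p → i ≠ Sum.inr p → spMat (t * g) i j = spMat g i j := by
  obtain ⟨t, ht⟩ := exists_homothety (Pi.single (Sum.inl p) 1)
    (by simp [Pi.single_apply, ite_pow]) α β h
  refine ⟨t, fun g j => ?_⟩
  have key (i) := ht (fun i => spMat g i j) i
  have e (i) : spMat (t * g) i j = (spMat t *ᵥ fun i => spMat g i j) i := by
    simp [Matrix.mul_apply, mulVec, dotProduct]
  simp only [mulJ_single, Pi.single_apply, apply_ite Complex.ofReal, Complex.ofReal_one,
    Complex.ofReal_zero, ite_mul, one_mul, zero_mul, sum_ite_eq', mem_univ, if_true] at key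
  refine ⟨?_, ?_, fun i hi hi' => ?_⟩
  · rw [e, key]; simp; ring
  · rw [e, key]; simp; ring
  · rw [e, key]; simp [hi, hi']

theorem exists_mul_apply_rotation {N : ℕ} (p : Fin N) {i : Fin N ⊕ Fin N} (hi : i ≠ Sum.inl p)
    {c s : ℝ} (hcs : c ^ 2 + s ^ 2 = 1) (hs : 0 < s) :
    ∃ t : SpGroup N, ∀ (g : SpGroup N) (j : Fin N ⊕ Fin N),
      spMat (t * g) (Sum.inl p) j = c * spMat g (Sum.inl p) j + s * spMat g i j := by
  have hcs' : (c : ℂ) ^ 2 + (s : ℂ) ^ 2 = 1 := by exact_mod_cast hcs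
  by_cases hi' : i = Sum.inr p
  · obtain ⟨t, ht⟩ := exists_mul_apply_plane p c (-s) (by simp [← pow_two, hcs'])
    refine ⟨t, fun g j => ?_⟩
    rw [(ht g j).1, hi']
    simp
  · have hc : 0 < (1 - c) / 2 := by nlinarith [sq_nonneg (c - 1), sq_pos_of_pos hs]
    set a := √((1 - c) / 2) with ha
    have ha0 : 0 < a := Real.sqrt_pos.mpr hc
    have ha2 : a ^ 2 = (1 - c) / 2 := Real.sq_sqrt hc.le
    set b := -s / (2 * a) with hb
    have hab : a * b = - s / 2 := by rw [hb]; field_simp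
    have hb2 : a ^ 2 + b ^ 2 = 1 := by
      have : a ^ 2 * (a ^ 2 + b ^ 2 - 1) = 0 := by
        have : a ^ 2 * (a ^ 2 + b ^ 2 - 1) = a ^ 2 * a ^ 2 + (a * b) ^ 2 - a ^ 2 := by ring
        rw [this, hab, ha2]
        linear_combination hcs / 4
      rcases mul_eq_zero.mp this with h | h
      · exact absurd h (by positivity)
      · linarith
    obtain ⟨t, ht⟩ := exists_homothety (Pi.single (Sum.inl p) a + Pi.single i b)
      (by
        have e (j : Fin N ⊕ Fin N) :
            (Pi.single (Sum.inl p) a + Pi.single i b : Fin N ⊕ Fin N → ℝ) j ^ 2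
            = (if j = Sum.inl p then a ^ 2 else 0) + if j = i then b ^ 2 else 0 := by
          by_cases h1 : j = Sum.inl p <;> by_cases h2 : j = i <;> simp_all
        simp only [e, sum_add_distrib, sum_ite_eq', mem_univ, if_true, hb2]) (-1) 0 (by simp)
    refine ⟨t, fun g j => ?_⟩
    have key := ht (fun i => spMat g i j) (Sum.inl p)
    have e : spMat (t * g) (Sum.inl p) j = (spMat t *ᵥ fun i => spMat g i j) (Sum.inl p) := by
      simp [Matrix.mul_apply, mulVec, dotProduct]
    have hx : ∑ j' : Fin N ⊕ Fin N, (((Pi.single (Sum.inl p) a + Pi.single i b :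
        Fin N ⊕ Fin N → ℝ) j' : ℝ) : ℂ) * spMat g j' j
        = a * spMat g (Sum.inl p) j + b * spMat g i j := by
      simp [Pi.single_apply, add_mul, sum_add_distrib, apply_ite Complex.ofReal]
    have hxp : (Pi.single (Sum.inl p) a + Pi.single i b : Fin N ⊕ Fin N → ℝ) (Sum.inl p) = a := by
      simp [hi.symm]
    have hJ : mulJ (Pi.single (Sum.inl p) a + Pi.single i b) (Sum.inl p) = 0 := by
      simp [mulJ, Pi.single_apply, Ne.symm hi']
    rw [e, key, hx, hxp, hJ]
    have ha2' : (a : ℂ) ^ 2 = (1 - c) / 2 := by rw [← Complex.ofReal_pow, ha2]; push_cast; ring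
    have hab' : (a : ℂ) * b = -s / 2 := by rw [← Complex.ofReal_mul, hab]; push_cast; ring
    simp only [Complex.ofReal_zero, map_zero, zero_mul, sub_zero, add_zero]
    linear_combination (-2 * spMat g (Sum.inl p) j) * ha2' - 2 * spMat g i j * hab'

end SpGroup

/-- The mixed absolute moments of a pair of complex random variables whose joint distribution is
invariant under rotations. -/
theorem choose_mul_integral_mul_conj_pow {Ω : Type*} [MeasurableSpace Ω] {μ : Measure Ω}
    {z w : Ω → ℂ}
    (hint : ∀ a b c d : ℕ, Integrable (fun x => z x ^ a * star (z x) ^ b *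
      (w x ^ c * star (w x) ^ d)) μ) {p : ℕ}
    (hkill : ∀ a b c d : ℕ, a ≠ b → a + c = p → b + d = p →
      ∫ x, z x ^ a * star (z x) ^ b * (w x ^ c * star (w x) ^ d) ∂μ = 0)
    (hrot : ∀ c s : ℝ, 0 < c → 0 < s → c ^ 2 + s ^ 2 = 1 →
      ∫ x, (c * z x + s * w x) ^ p * star (c * z x + s * w x) ^ p ∂μ
        = ∫ x, z x ^ p * star (z x) ^ p ∂μ) {j : ℕ} (hj : j ≤ p) :
    p.choose j * ∫ x, z x ^ j * star (z x) ^ j * (w x ^ (p - j) * star (w x) ^ (p - j)) ∂μ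
      = ∫ x, z x ^ p * star (z x) ^ p ∂μ := by
  set M : ℕ → ℂ := fun j =>
    ∫ x, z x ^ j * star (z x) ^ j * (w x ^ (p - j) * star (w x) ^ (p - j)) ∂μ with hM
  set m := ∫ x, z x ^ p * star (z x) ^ p ∂μ with hm
  have expand (c s : ℝ) (hc : 0 < c) (hs : 0 < s) (hcs : c ^ 2 + s ^ 2 = 1) :
      ∑ j ∈ range (p + 1), (p.choose j : ℂ) ^ 2 * (c ^ 2) ^ j * (s ^ 2) ^ (p - j) * M j = m := by
    rw [← hrot c s hc hs hcs]
    have e (x) : (c * z x + s * w x) ^ p * star (c * z x + s * w x) ^ p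
        = ∑ i ∈ range (p + 1), ∑ j ∈ range (p + 1),
          (p.choose i * p.choose j * c ^ i * s ^ (p - i) * c ^ j * s ^ (p - j) : ℂ) *
          (z x ^ i * star (z x) ^ j * (w x ^ (p - i) * star (w x) ^ (p - j))) := by
      have : star (c * z x + s * w x) = c * star (z x) + s * star (w x) := by simp
      rw [this, add_pow, add_pow, sum_mul_sum]
      refine sum_congr rfl fun i _ => sum_congr rfl fun j _ => ?_
      ring
    simp only [e]
    rw [integral_finsetSum _ fun i _ => integrable_finsetSum _ fun j _ =>
      (hint _ _ _ _).const_mul _]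
    refine sum_congr rfl fun i hi => ?_
    rw [integral_finsetSum _ fun j _ => (hint _ _ _ _).const_mul _, sum_eq_single_of_mem i hi]
    · rw [integral_const_mul]
      ring
    · intro j hj hji
      rw [integral_const_mul, hkill _ _ _ _ hji.symm, mul_zero]
      · exact Nat.add_sub_cancel' (mem_range_succ_iff.mp hi)
      · exact Nat.add_sub_cancel' (mem_range_succ_iff.mp hj)
  have hpoly : ∑ j ∈ range (p + 1), Polynomial.C ((p.choose j : ℂ) ^ 2 * M j) * Polynomial.X ^ j
      = Polynomial.C m * (Polynomial.X + 1) ^ p := by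
    refine Polynomial.eq_of_infinite_eval_eq _ _
      (Set.Infinite.mono (s := (fun t : ℝ => (t : ℂ)) '' Set.Ioi 0) ?_
        ((Set.Ioi_infinite 0).image Complex.ofReal_injective.injOn))
    rintro _ ⟨t, ht, rfl⟩
    have ht : 0 < t := ht
    have h1 : 0 < 1 + t := by linarith
    have hc2 : √(t / (1 + t)) ^ 2 = t / (1 + t) := Real.sq_sqrt (by positivity)
    have hs2 : √(1 / (1 + t)) ^ 2 = 1 / (1 + t) := Real.sq_sqrt (by positivity)
    have := expand √(t / (1 + t)) √(1 / (1 + t)) (by positivity) (by positivity)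
      (by rw [hc2, hs2]; field_simp; ring)
    have h1' : (1 + t : ℂ) ≠ 0 := by exact_mod_cast h1.ne'
    simp only [← Complex.ofReal_pow, hc2, hs2] at this
    simp only [Set.mem_ofPred_eq, Polynomial.eval_finsetSum, Polynomial.eval_mul,
      Polynomial.eval_C, Polynomial.eval_pow, Polynomial.eval_X, Polynomial.eval_add,
      Polynomial.eval_one]
    rw [← this, sum_mul]
    refine sum_congr rfl fun j hj => ?_
    obtain ⟨b, hb⟩ := Nat.exists_eq_add_of_le' (mem_range_succ_iff.mp hj)
    rw [hb, Nat.add_sub_cancel]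
    push_cast
    rw [add_comm (t : ℂ), div_pow, div_pow, one_pow, pow_add]
    field_simp
  have hcoeff := congrArg (fun f => Polynomial.coeff f j) hpoly
  simp only [Polynomial.finsetSum_coeff, Polynomial.coeff_C_mul, Polynomial.coeff_X_pow,
    Polynomial.coeff_X_add_one_pow, mul_ite, mul_one, mul_zero, sum_ite_eq, mem_range,
    Nat.lt_succ_of_le hj, if_true] at hcoeff
  have : (p.choose j : ℂ) ≠ 0 := by exact_mod_cast (Nat.choose_pos hj).ne'
  apply mul_right_cancel₀ this
  rw [← hcoeff]
  ring

namespace SpGroup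

open ComplexConjugate

variable {N : ℕ} {μ : Measure (SpGroup N)}

theorem continuous_spMat_apply (i j : Fin N ⊕ Fin N) :
    Continuous fun g : SpGroup N => spMat g i j :=
  continuous_spMat.matrix_elem i j

theorem integrable_monomial [IsFiniteMeasure μ] (i i' j : Fin N ⊕ Fin N) (a b c d : ℕ) :
    Integrable (fun g => spMat g i j ^ a * star (spMat g i j) ^ b *
      (spMat g i' j ^ c * star (spMat g i' j) ^ d)) μ := by
  have := continuous_spMat_apply i j
  have := continuous_spMat_apply i' j
  exact integrable_of_continuous (by fun_prop)

variable [μ.IsMulLeftInvariant]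

theorem integral_eq_zero_of_mul_left_eq_neg {f : SpGroup N → ℂ} (t : SpGroup N)
    (h : ∀ g, f (t * g) = -f g) : ∫ g, f g ∂μ = 0 := by
  have := integral_mul_left_eq_self (μ := μ) f t
  simp only [h, integral_neg] at this
  exact self_eq_neg.mp this.symm

theorem exists_rotation_pow_eq_neg_one {a b : ℕ} (hab : a ≠ b) :
    ∃ α : ℂ, α * conj α = 1 ∧ α ^ a * conj α ^ b = -1 := by
  have h : ((a : ℂ) - b) ≠ 0 := sub_ne_zero.mpr (by exact_mod_cast hab)
  refine ⟨Complex.exp (Real.pi / (a - b) * Complex.I), ?_, ?_⟩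
  · rw [← Complex.exp_conj, ← Complex.exp_add]
    simp
  · rw [← Complex.exp_conj, ← Complex.exp_nat_mul, ← Complex.exp_nat_mul, ← Complex.exp_add,
      ← Complex.exp_pi_mul_I]
    congr 1
    simp
    field_simp
    ring

theorem integral_monomial_eq_zero (p : Fin N) {i : Fin N ⊕ Fin N} (hi : i ≠ Sum.inl p)
    (j : Fin N ⊕ Fin N) {a b c d : ℕ} (hab : a ≠ b) (h : a + c = b + d) :
    ∫ g, spMat g (Sum.inl p) j ^ a * star (spMat g (Sum.inl p) j) ^ b *
      (spMat g i j ^ c * star (spMat g i j) ^ d) ∂μ = 0 := by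
  by_cases hi' : i = Sum.inr p
  · obtain ⟨α, hα, hα'⟩ := exists_rotation_pow_eq_neg_one (a := a + d) (b := b + c) (by omega)
    obtain ⟨t, ht⟩ := exists_mul_apply_plane p α 0 (by simpa using hα)
    refine integral_eq_zero_of_mul_left_eq_neg t fun g => ?_
    rw [(ht g j).1, hi', (ht g j).2.1]
    simp only [map_zero, zero_mul, sub_zero, zero_add, star_mul', RCLike.star_def,
      Complex.conj_conj]
    linear_combination (spMat g (Sum.inl p) j ^ a * conj (spMat g (Sum.inl p) j) ^ b *
      (spMat g (Sum.inr p) j ^ c * conj (spMat g (Sum.inr p) j) ^ d)) * hα'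
  · obtain ⟨α, hα, hα'⟩ := exists_rotation_pow_eq_neg_one hab
    obtain ⟨t, ht⟩ := exists_mul_apply_plane p α 0 (by simpa using hα)
    refine integral_eq_zero_of_mul_left_eq_neg t fun g => ?_
    rw [(ht g j).1, (ht g j).2.2 i hi hi']
    simp only [map_zero, zero_mul, sub_zero, star_mul', RCLike.star_def]
    linear_combination (spMat g (Sum.inl p) j ^ a * conj (spMat g (Sum.inl p) j) ^ b *
      (spMat g i j ^ c * conj (spMat g i j) ^ d)) * hα'

/-- Monomials in the two coordinates of a quaternionic entry have zero mean unless they are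
invariant under phase changes. -/
theorem integral_monomial_mul_eq_zero (p : Fin N) (j : Fin N ⊕ Fin N) {a b : ℕ} (hab : a ≠ b)
    (c : ℕ) :
    ∫ g, spMat g (Sum.inl p) j ^ a * star (spMat g (Sum.inl p) j) ^ b *
      (spMat g (Sum.inr p) j ^ c * star (spMat g (Sum.inr p) j) ^ c) ∂μ = 0 := by
  obtain ⟨α, hα, hα'⟩ := exists_rotation_pow_eq_neg_one hab
  obtain ⟨t, ht⟩ := exists_mul_apply_plane p α 0 (by simpa using hα)
  refine integral_eq_zero_of_mul_left_eq_neg t fun g => ?_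
  rw [(ht g j).1, (ht g j).2.1]
  simp only [map_zero, zero_mul, sub_zero, zero_add, star_mul', RCLike.star_def,
    Complex.conj_conj]
  have hα'' : (α * conj α) ^ c = 1 := by rw [hα, one_pow]
  calc _ = (α ^ a * conj α ^ b) * (α * conj α) ^ c *
        (spMat g (Sum.inl p) j ^ a * conj (spMat g (Sum.inl p) j) ^ b *
        (spMat g (Sum.inr p) j ^ c * conj (spMat g (Sum.inr p) j) ^ c)) := by ring
    _ = _ := by rw [hα', hα'']; ring

theorem choose_mul_integral_monomial [IsFiniteMeasure μ] (p : Fin N) {i : Fin N ⊕ Fin N}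
    (hi : i ≠ Sum.inl p) (j : Fin N ⊕ Fin N) (a c : ℕ) :
    (a + c).choose a * ∫ g, spMat g (Sum.inl p) j ^ a * star (spMat g (Sum.inl p) j) ^ a *
      (spMat g i j ^ c * star (spMat g i j) ^ c) ∂μ
      = ∫ g, spMat g (Sum.inl p) j ^ (a + c) * star (spMat g (Sum.inl p) j) ^ (a + c) ∂μ := by
  have := choose_mul_integral_mul_conj_pow (μ := μ) (z := fun g => spMat g (Sum.inl p) j)
    (w := fun g => spMat g i j) (p := a + c) (j := a)
    (fun a b c d => integrable_monomial _ _ _ _ _ _ _)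
    (fun a b c d hab h h' => integral_monomial_eq_zero p hi j hab (h.trans h'.symm))
    (fun c s _ hs hcs => by
      obtain ⟨t, ht⟩ := exists_mul_apply_rotation p hi hcs hs
      simp only [← ht _ j]
      exact integral_mul_left_eq_self
        (fun g => spMat g (Sum.inl p) j ^ (a + _) * star (spMat g (Sum.inl p) j) ^ (a + _)) t)
    (Nat.le_add_right a c)
  simpa using this

theorem sum_mul_star_apply (g : SpGroup N) (j : Fin N ⊕ Fin N) :
    ∑ i, spMat g i j * star (spMat g i j) = 1 := by
  have := congrFun (congrFun (conjTranspose_mul_self g) j) j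
  simpa [Matrix.mul_apply, mul_comm] using this

open Nat in
theorem integral_pow_mul_star_pow [IsProbabilityMeasure μ] (p : Fin N) (j : Fin N ⊕ Fin N)
    (q : ℕ) :
    ∫ g, spMat g (Sum.inl p) j ^ q * star (spMat g (Sum.inl p) j) ^ q ∂μ
      = q ! * (2 * N - 1)! / (2 * N - 1 + q)! := by
  have hf (n : ℕ) : (n ! : ℂ) ≠ 0 := by exact_mod_cast n.factorial_ne_zero
  induction q with
  | zero => simp [div_self, hf]
  | succ q ih =>
    set m := ∫ g, spMat g (Sum.inl p) j ^ (q + 1) * star (spMat g (Sum.inl p) j) ^ (q + 1) ∂μ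
      with hm
    have hN : 0 < N := p.pos
    have key : (q + 1) * ∫ g, spMat g (Sum.inl p) j ^ q * star (spMat g (Sum.inl p) j) ^ q ∂μ
        = (q + 2 * N) * m := by
      have e (g : SpGroup N) : spMat g (Sum.inl p) j ^ q * star (spMat g (Sum.inl p) j) ^ q
          = ∑ i, spMat g (Sum.inl p) j ^ q * star (spMat g (Sum.inl p) j) ^ q *
            (spMat g i j ^ 1 * star (spMat g i j) ^ 1) := by
        simp only [pow_one]
        rw [← mul_sum, sum_mul_star_apply, mul_one]
      rw [integral_congr_ae (ae_of_all μ e),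
        integral_finsetSum _ fun i _ => integrable_monomial _ _ _ _ _ _ _, mul_sum,
        ← Finset.add_sum_erase _ _ (mem_univ (Sum.inl p))]
      have h1 : ∀ i ∈ univ.erase (Sum.inl p : Fin N ⊕ Fin N),
          (q + 1 : ℂ) * ∫ g, spMat g (Sum.inl p) j ^ q * star (spMat g (Sum.inl p) j) ^ q *
            (spMat g i j ^ 1 * star (spMat g i j) ^ 1) ∂μ = m := fun i hi => by
        rw [hm, ← choose_mul_integral_monomial p (ne_of_mem_erase hi) j q 1]
        simp
      have h2 : ∫ g, spMat g (Sum.inl p) j ^ q * star (spMat g (Sum.inl p) j) ^ q *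
            (spMat g (Sum.inl p) j ^ 1 * star (spMat g (Sum.inl p) j) ^ 1) ∂μ = m := by
        rw [hm]
        congr 1 with g
        ring
      rw [sum_congr rfl h1, h2, sum_const, card_erase_of_mem (mem_univ _)]
      simp only [Finset.card_univ, Fintype.card_sum, Fintype.card_fin, nsmul_eq_mul]
      rw [Nat.cast_sub (by omega)]
      push_cast
      ring
    have hq : (q + 2 * N : ℂ) ≠ 0 := by exact_mod_cast (by omega : q + 2 * N ≠ 0)
    obtain ⟨r, hr⟩ : ∃ r, 2 * N = r + 1 := ⟨2 * N - 1, by omega⟩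
    have hr' : (2 * N : ℂ) = r + 1 := by exact_mod_cast hr
    rw [hr] at ih ⊢
    rw [hr'] at key hq
    rw [ih] at key
    apply mul_left_cancel₀ hq
    rw [← key, Nat.add_sub_cancel, ← Nat.add_assoc r q 1, Nat.factorial_succ, Nat.factorial_succ]
    push_cast
    have := hf (r + q)
    have hq' : (r + q + 1 : ℂ) ≠ 0 := by convert hq using 1; ring
    field_simp
    ring

open Nat in
theorem integral_monomial [IsProbabilityMeasure μ] (p : Fin N) {i : Fin N ⊕ Fin N}
    (hi : i ≠ Sum.inl p) (j : Fin N ⊕ Fin N) (a c : ℕ) :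
    ∫ g, spMat g (Sum.inl p) j ^ a * star (spMat g (Sum.inl p) j) ^ a *
      (spMat g i j ^ c * star (spMat g i j) ^ c) ∂μ
      = a ! * c ! * (2 * N - 1)! / (2 * N - 1 + a + c)! := by
  have hf (n : ℕ) : (n ! : ℂ) ≠ 0 := by exact_mod_cast n.factorial_ne_zero
  have h := choose_mul_integral_monomial (μ := μ) p hi j a c
  rw [integral_pow_mul_star_pow, ← add_assoc] at h
  have hc : ((a + c).choose a : ℂ) * a ! * c ! = (a + c)! := by
    rw [Nat.choose_symm_add]
    exact_mod_cast Nat.add_choose_mul_factorial_mul_factorial a c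
  have hc0 : ((a + c).choose a : ℂ) ≠ 0 := by
    exact_mod_cast (Nat.choose_pos (Nat.le_add_right a c)).ne'
  apply mul_left_cancel₀ hc0
  rw [h, ← hc]
  ring

theorem spMat_mul_Jmat (g : SpGroup N) : spMat g * Jmat N = Jmat N * (spMat g).map star := by
  have h := mul_Jmat_mul_transpose g
  have h' : (spMat g)ᵀ * (spMat g).map star = 1 := by
    rw [← transpose_one, ← conjTranspose_mul_self g, transpose_mul]
    rfl
  rw [← Matrix.mul_one (spMat g * Jmat N), ← h', ← Matrix.mul_assoc, h]

theorem spMat_inr_inr (g : SpGroup N) (i j : Fin N) :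
    spMat g (Sum.inr i) (Sum.inr j) = star (spMat g (Sum.inl i) (Sum.inl j)) := by
  have := congrFun (congrFun (spMat_mul_Jmat g) (Sum.inr i)) (Sum.inl j)
  simpa [Jmat, Matrix.mul_apply, Matrix.one_apply] using this

theorem spMat_inl_inr (g : SpGroup N) (i j : Fin N) :
    spMat g (Sum.inl i) (Sum.inr j) = -star (spMat g (Sum.inr i) (Sum.inl j)) := by
  have := congrFun (congrFun (spMat_mul_Jmat g) (Sum.inl i)) (Sum.inl j)
  simpa [Jmat, Matrix.mul_apply, Matrix.one_apply, neg_eq_iff_eq_neg] using this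

end SpGroup

open Nat in
/-- The `k`-th moment of the determinant of a `2 × 2` corner, as a sum of moments of monomials. -/
theorem sum_choose_mul_factorial_div (r k : ℕ) :
    ∑ c ∈ range (k + 1), ∑ a ∈ range (k - c + 1), (k.choose c : ℂ) * (k - c).choose a ^ 2 *
        (a ! * c ! * r ! / (r + a + c)!)
      = r ! * (2 * k + r + 1)! / ((k + r)! * (k + r + 1)!) := by
  have hf (n : ℕ) : (n ! : ℂ) ≠ 0 := by exact_mod_cast n.factorial_ne_zero
  have inner (c : ℕ) (hc : c ∈ range (k + 1)) :
      ∑ a ∈ range (k - c + 1), (k.choose c : ℂ) * (k - c).choose a ^ 2 *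
        (a ! * c ! * r ! / (r + a + c)!)
      = k ! * r ! / (k + r)! * ((k - c) + (k + r)).choose (k + r) := by
    obtain ⟨m, rfl⟩ := Nat.exists_eq_add_of_le' (mem_range_succ_iff.mp hc)
    rw [Nat.add_sub_cancel]
    have hv : (m + (m + c + r)).choose (m + c + r)
        = ∑ a ∈ range (m + 1), m.choose a * (m + c + r).choose (m - a) := by
      rw [← Nat.choose_symm_add, Nat.add_choose_eq,
        Finset.Nat.sum_antidiagonal_eq_sum_range_succ fun i j => m.choose i * (m + c + r).choose j]
    rw [hv, Nat.cast_sum, Finset.mul_sum]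
    refine Finset.sum_congr rfl fun a ha => ?_
    obtain ⟨b, rfl⟩ := Nat.exists_eq_add_of_le' (mem_range_succ_iff.mp ha)
    rw [Nat.add_sub_cancel]
    have h1 := Nat.add_choose_mul_factorial_mul_factorial (b + a) c
    have h2 := Nat.add_choose_mul_factorial_mul_factorial b a
    have h3 := Nat.add_choose_mul_factorial_mul_factorial b (r + a + c)
    rw [← Nat.choose_symm_add] at h3
    have e : b + a + c + r = b + (r + a + c) := by ring
    rw [e]
    push_cast
    have h1' : ((b + a + c).choose c : ℂ) * (b + a)! * c ! = (b + a + c)! := by exact_mod_cast h1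
    have h2' : ((b + a).choose a : ℂ) * b ! * a ! = (b + a)! := by exact_mod_cast h2
    have h3' : ((b + (r + a + c)).choose b : ℂ) * b ! * (r + a + c)! = (b + (r + a + c))! := by
      exact_mod_cast h3
    have := hf (r + a + c)
    have := hf (b + (r + a + c))
    rw [← h1', ← h2']
    field_simp
    rw [← h3']
    ring
  rw [Finset.sum_congr rfl inner, ← Finset.mul_sum, ← Nat.cast_sum]
  have := Finset.sum_range_reflect (fun m => (m + (k + r)).choose (k + r)) (k + 1)
  simp only [Nat.add_sub_cancel] at this
  have hs : ∑ c ∈ range (k + 1), ((k - c) + (k + r)).choose (k + r)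
      = (k + (k + r + 1)).choose k := by
    rw [Nat.choose_symm_add, ← add_assoc, ← Nat.sum_range_add_choose, ← this]
  have hc := Nat.add_choose_mul_factorial_mul_factorial k (k + r + 1)
  rw [← Nat.choose_symm_add] at hc
  have hc' : ((k + (k + r + 1)).choose k : ℂ) * k ! * (k + r + 1)! = (k + (k + r + 1))! := by
    exact_mod_cast hc
  rw [hs, show 2 * k + r + 1 = k + (k + r + 1) by ring, ← hc']
  have := hf (k + r + 1)
  field_simp

open Nat in
/-- The recursion in `N` of the product formula for the moments. -/
theorem momentFormula_succ (N k : ℕ) :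
    ((N + 1 + k) ! : ℂ) / ((N + 1) ! * k !) * ∏ i ∈ Icc 1 k,
        (((k + 2 * (N + 1) + i) ! * i ! : ℂ) / ((2 * i + 2 * (N + 1)) ! * (2 * i - 1) !))
      = (2 * N + 1) ! * (2 * k + (2 * N + 1) + 1) ! /
          ((k + (2 * N + 1)) ! * (k + (2 * N + 1) + 1) !)
        * ((N + k) ! / (N ! * k !) * ∏ i ∈ Icc 1 k,
          (((k + 2 * N + i) ! * i ! : ℂ) / ((2 * i + 2 * N) ! * (2 * i - 1) !))) := by
  have hf (n : ℕ) : (n ! : ℂ) ≠ 0 := by exact_mod_cast n.factorial_ne_zero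
  have hn (n : ℕ) : (n + 1 : ℂ) ≠ 0 := by exact_mod_cast n.succ_ne_zero
  have num (M : ℕ) (j : ℕ) : ∏ i ∈ Icc 1 j, ((M + 2 + i) ! : ℂ)
      = (∏ i ∈ Icc 1 j, ((M + i) ! : ℂ)) *
        ((M + j + 1) ! * (M + j + 2) ! / ((M + 1) ! * (M + 2) !)) := by
    induction j with
    | zero => simp [div_self, hf]
    | succ j ih =>
      rw [prod_Icc_succ_top (by simp), prod_Icc_succ_top (by simp), ih]
      have := hf (M + 1)
      have := hf (M + 2)
      field_simp
      rw [show M + 2 + (j + 1) = M + j + 1 + 1 + 1 by ring,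
        show M + (j + 1) + 1 = M + j + 1 + 1 by ring,
        show M + (j + 1) + 2 = M + j + 1 + 1 + 1 by ring,
        show M + j + 2 = M + j + 1 + 1 by ring, show M + (j + 1) = M + j + 1 by ring]
  have den (j : ℕ) : ∏ i ∈ Icc 1 j, ((2 * i + 2 * (N + 1)) ! : ℂ)
      = (∏ i ∈ Icc 1 j, ((2 * i + 2 * N) ! : ℂ)) * ((2 * j + 2 * N + 2) ! / (2 * N + 2) !) := by
    induction j with
    | zero => simp [div_self, hf]
    | succ j ih =>
      rw [prod_Icc_succ_top (by simp), prod_Icc_succ_top (by simp), ih]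
      have := hf (2 * N + 2)
      field_simp
      rw [show 2 * (j + 1) + 2 * N = 2 * j + 2 * N + 2 by ring,
        show 2 * (j + 1) + 2 * (N + 1) = 2 * j + 2 * N + 2 + 2 by ring]
  have hp (f : ℕ → ℕ) : ∏ i ∈ Icc 1 k, ((f i) ! : ℂ) ≠ 0 := prod_ne_zero_iff.mpr fun i _ => hf _
  simp only [prod_div_distrib, prod_mul_distrib, den]
  rw [show k + 2 * (N + 1) = k + 2 * N + 2 by ring, num]
  have h1 := hp fun i => 2 * i + 2 * N
  have h2 := hp fun i => 2 * i - 1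
  have h3 := hf k
  have h4 := hf N
  have h5 := hf (N + k)
  have h6 := hf (2 * N)
  have h7 := hf (2 * k + 2 * N)
  have h8 := hf (k + 2 * N)
  simp only [show N + 1 + k = N + k + 1 by ring,
    show 2 * k + (2 * N + 1) + 1 = 2 * k + 2 * N + 1 + 1 by ring,
    show k + (2 * N + 1) = k + 2 * N + 1 by ring, show k + 2 * N + k = 2 * k + 2 * N by ring,
    Nat.factorial_succ]
  push_cast
  have g1 := hn N
  have g2 : (2 * (k + N) + 1 : ℂ) ≠ 0 := by exact_mod_cast (2 * (k + N)).succ_ne_zero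
  have g3 : (2 * (k + N) + 1 + 1 : ℂ) ≠ 0 := by exact_mod_cast (2 * (k + N) + 1).succ_ne_zero
  have g4 : (k + N * 2 + 1 : ℂ) ≠ 0 := by exact_mod_cast (k + N * 2).succ_ne_zero
  have g5 : (k + N * 2 + 1 + 1 : ℂ) ≠ 0 := by exact_mod_cast (k + N * 2 + 1).succ_ne_zero
  have g6 : (N * 2 + 1 : ℂ) ≠ 0 := by exact_mod_cast (N * 2).succ_ne_zero
  have g7 : (N * 2 + 1 + 1 : ℂ) ≠ 0 := by exact_mod_cast (N * 2 + 1).succ_ne_zero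
  field_simp
  ring

open Nat in
theorem prod_factorial_mul_factorial (k : ℕ) :
    ∏ i ∈ Icc 1 k, ((k + i)! * i !) = ∏ i ∈ Icc 1 k, ((2 * i)! * (2 * i - 1)!) := by
  have shift (M j : ℕ) : (∏ i ∈ Icc 1 j, (M + 1 + i)!) * (M + 1)!
      = (∏ i ∈ Icc 1 j, (M + i)!) * (M + j + 1)! := by
    induction j with
    | zero => simp
    | succ j ih =>
      rw [prod_Icc_succ_top (by simp), prod_Icc_succ_top (by simp), mul_right_comm, ih]
      ring_nf
  induction k with
  | zero => simp
  | succ k ih =>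
    rw [prod_Icc_succ_top (by simp), prod_Icc_succ_top (by simp), ← ih, prod_mul_distrib,
      prod_mul_distrib]
    have e := shift k k
    rw [show k + 1 + (k + 1) = 2 * (k + 1) by ring, show 2 * (k + 1) - 1 = k + k + 1 by omega]
    linear_combination (∏ i ∈ Icc 1 k, i !) * (2 * (k + 1))! * e

open Nat in
theorem momentFormula_zero (k : ℕ) :
    ((0 + k) ! : ℂ) / (0 ! * k !) * ∏ i ∈ Icc 1 k,
        (((k + 2 * 0 + i) ! * i ! : ℂ) / ((2 * i + 2 * 0) ! * (2 * i - 1) !)) = 1 := by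
  have hf (n : ℕ) : (n ! : ℂ) ≠ 0 := by exact_mod_cast n.factorial_ne_zero
  have h : ∏ i ∈ Icc 1 k, ((k + i)! * i ! : ℂ) = ∏ i ∈ Icc 1 k, ((2 * i)! * (2 * i - 1)! : ℂ) := by
    exact_mod_cast prod_factorial_mul_factorial k
  simp only [mul_zero, add_zero, zero_add, factorial_zero, cast_one, one_mul]
  rw [prod_div_distrib, h, div_self (hf k), div_self, one_mul]
  exact prod_ne_zero_iff.mpr fun i _ => mul_ne_zero (hf _) (hf _)

theorem det_fin_one_sum_fin_one {R : Type*} [CommRing R]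
    (M : Matrix (Fin 1 ⊕ Fin 1) (Fin 1 ⊕ Fin 1) R) :
    M.det = M (Sum.inl 0) (Sum.inl 0) * M (Sum.inr 0) (Sum.inr 0)
      - M (Sum.inl 0) (Sum.inr 0) * M (Sum.inr 0) (Sum.inl 0) := by
  rw [← det_submatrix_equiv_self finSumFinEquiv.symm, det_fin_two]
  rfl

namespace SpGroup

theorem det_one_sub_corner {N : ℕ} (g : SpGroup (N + 1)) :
    let p := splitIndex N (Sum.inl 0)
    (1 - corner g).det
      = (1 - spMat g (Sum.inl p) (Sum.inl p)) * (1 - star (spMat g (Sum.inl p) (Sum.inl p)))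
        + spMat g (Sum.inr p) (Sum.inl p) * star (spMat g (Sum.inr p) (Sum.inl p)) := by
  intro p
  have e (i j : Fin 1 ⊕ Fin 1) : corner g i j
      = spMat g (blockIndex N (Sum.inl i)) (blockIndex N (Sum.inl j)) := rfl
  have hl : blockIndex N (Sum.inl (Sum.inl 0)) = Sum.inl p := rfl
  have hr : blockIndex N (Sum.inl (Sum.inr 0)) = Sum.inr p := rfl
  rw [det_fin_one_sum_fin_one]
  simp only [Matrix.sub_apply, e, hl, hr, spMat_inr_inr, spMat_inl_inr, Matrix.one_apply]
  simp
  ring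

open Nat in
theorem integral_det_one_sub_corner_pow {N : ℕ} (k : ℕ) (μ : Measure (SpGroup (N + 1)))
    [μ.IsMulLeftInvariant] [IsProbabilityMeasure μ] :
    ∫ g, (1 - corner g).det ^ k ∂μ
      = (2 * N + 1)! * (2 * k + (2 * N + 1) + 1)! /
        ((k + (2 * N + 1))! * (k + (2 * N + 1) + 1)!) := by
  set p := splitIndex N (Sum.inl 0) with hp
  have e (g : SpGroup (N + 1)) : (1 - corner g).det ^ k
      = ∑ c ∈ range (k + 1), ∑ a ∈ range (k - c + 1), ∑ b ∈ range (k - c + 1),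
        (k.choose c * ((k - c).choose a * (k - c).choose b) * ((-1) ^ a * (-1) ^ b) : ℂ) *
        (spMat g (Sum.inl p) (Sum.inl p) ^ a * star (spMat g (Sum.inl p) (Sum.inl p)) ^ b *
          (spMat g (Sum.inr p) (Sum.inl p) ^ c * star (spMat g (Sum.inr p) (Sum.inl p)) ^ c)) := by
    rw [det_one_sub_corner, add_comm, add_pow]
    refine sum_congr rfl fun c _ => ?_
    rw [mul_pow (1 - _), sub_eq_neg_add, sub_eq_neg_add, add_pow, add_pow, sum_mul_sum, mul_sum,
      sum_mul]
    refine sum_congr rfl fun a _ => ?_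
    rw [mul_sum, sum_mul]
    refine sum_congr rfl fun b _ => ?_
    rw [neg_pow, neg_pow (star _)]
    ring
  have hint (a b c : ℕ) (K : ℂ) := (integrable_monomial (μ := μ) (Sum.inl p) (Sum.inr p)
    (Sum.inl p) a b c c).const_mul K
  rw [integral_congr_ae (ae_of_all μ e), ← sum_choose_mul_factorial_div,
    integral_finsetSum _ fun c _ => integrable_finsetSum _ fun a _ => integrable_finsetSum _
      fun b _ => hint _ _ _ _]
  refine sum_congr rfl fun c _ => ?_
  rw [integral_finsetSum _ fun a _ => integrable_finsetSum _ fun b _ => hint _ _ _ _]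
  refine sum_congr rfl fun a ha => ?_
  rw [integral_finsetSum _ fun b _ => hint _ _ _ _, sum_eq_single_of_mem a ha]
  · rw [integral_const_mul, integral_monomial p (by simp), ← mul_pow, neg_one_mul, neg_neg,
      one_pow, mul_one, ← pow_two]
    rfl
  · intro b _ hb
    rw [integral_const_mul, integral_monomial_mul_eq_zero p _ hb.symm, mul_zero]

theorem exists_probability_isMulLeftInvariant (N : ℕ) :
    ∃ ν : Measure (SpGroup N), ν.IsMulLeftInvariant ∧ IsProbabilityMeasure ν :=
  let K : TopologicalSpace.PositiveCompacts (SpGroup N) := ⊤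
  ⟨Measure.haarMeasure K, inferInstance, ⟨by simpa using! Measure.haarMeasure_self (K₀ := K)⟩⟩

theorem integral_det_one_sub_pow (N k : ℕ) (μ : Measure (SpGroup N)) [μ.IsMulLeftInvariant]
    [IsProbabilityMeasure μ] :
    (∫ g, Matrix.det (1 - spMat g) ^ k ∂μ)
      = ((N + k).factorial : ℂ) / ((N.factorial : ℂ) * k.factorial) *
        ∏ i ∈ Finset.Icc 1 k,
          ((((k + 2 * N + i).factorial : ℂ) * i.factorial) /
            (((2 * i + 2 * N).factorial : ℂ) * (2 * i - 1).factorial)) := by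
  induction N with
  | zero =>
    rw [momentFormula_zero]
    simp
  | succ N ih =>
    obtain ⟨ν, _, _⟩ := exists_probability_isMulLeftInvariant N
    rw [momentFormula_succ, integral_det_one_sub_pow_succ k μ ν, ih ν,
      integral_det_one_sub_corner_pow]

end SpGroup

/-- **Keating–Snaith moments for the compact symplectic group.** For all `N, k ∈ ℕ`,
`∫_{Sp(2N)} det(I − g)^k dg
  = ((N+k)!/(N!k!)) ∏_{i=1}^k ((k+2N+i)! i!)/((2i+2N)! (2i−1)!)`. -/
theorem moments_symplectic (N k : ℕ)
    (μ : Measure (SpGroup N)) [μ.IsHaarMeasure] [IsProbabilityMeasure μ] :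
    (∫ g, Matrix.det (1 - spMat g) ^ k ∂μ)
      = ((N + k).factorial : ℂ) / ((N.factorial : ℂ) * k.factorial) *
        ∏ i ∈ Finset.Icc 1 k,
          ((((k + 2 * N + i).factorial : ℂ) * i.factorial) /
            (((2 * i + 2 * N).factorial : ℂ) * (2 * i - 1).factorial)) := by
  exact SpGroup.integral_det_one_sub_pow N k μ
end
end

section
/- Let N ≥ 1 and k ≥ 0 be integers. Then ∫_{SO(2N)} det(I − g)^k dg = 2^{2Nk} · ∏_{j=1}^{N} ( Γ(N+j−1) · Γ(k+j−1/2) ) / ( Γ(N+k+j−1) · Γ(j−1/2) ), where Γ denotes the Gamma function. -/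
open MeasureTheory Matrix Finset

noncomputable section

/-- The determinant, as a monoid homomorphism from the real orthogonal group to `ℝ`. -/
def detHom (m : ℕ) : Matrix.orthogonalGroup (Fin m) ℝ →* ℝ where
  toFun g := Matrix.det (g : Matrix (Fin m) (Fin m) ℝ)
  map_one' := by simp
  map_mul' := by intro a b; simp

/-- The special orthogonal group `SO(m)`: real orthogonal `m × m` matrices of
determinant `1`, as a subgroup of the orthogonal group. -/
def SOGroup (m : ℕ) : Subgroup (Matrix.orthogonalGroup (Fin m) ℝ) :=
  MonoidHom.ker (detHom m)

/-- The real matrix underlying an element of `SO(m)`. -/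
def soMat {m : ℕ} (g : SOGroup m) : Matrix (Fin m) (Fin m) ℝ :=
  ((g : Matrix.orthogonalGroup (Fin m) ℝ) : Matrix (Fin m) (Fin m) ℝ)

instance matrixBorelSpace {m n : Type*} [Finite m] [Finite n] : BorelSpace (Matrix m n ℝ) := by
  cases nonempty_fintype m
  cases nonempty_fintype n
  exact inferInstanceAs (BorelSpace (m → n → ℝ))

instance matrixSecondCountable {m n : Type*} [Finite m] [Finite n] :
    SecondCountableTopology (Matrix m n ℝ) :=
  inferInstanceAs (SecondCountableTopology (m → n → ℝ))

section Orthogonal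

variable {n : ℕ}

lemma isCompact_orthogonalGroup :
    IsCompact (Matrix.orthogonalGroup (Fin n) ℝ : Set (Matrix (Fin n) (Fin n) ℝ)) := by
  have hc : IsCompact (Set.univ.pi fun _ : Fin n ↦ Set.univ.pi fun _ : Fin n ↦
      Set.Icc (-1 : ℝ) 1) :=
    isCompact_univ_pi fun _ ↦ isCompact_univ_pi fun _ ↦ isCompact_Icc
  refine hc.of_isClosed_subset (isClosed_unitary (R := Matrix (Fin n) (Fin n) ℝ))
    fun (g : Matrix (Fin n) (Fin n) ℝ) hg i _ j _ ↦ ?_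
  have h : ∑ l, g i l * g i l = 1 := by
    simpa [Matrix.mul_apply, Matrix.star_apply] using
      congrFun (congrFun (Matrix.mem_unitaryGroup_iff.1 hg) i) i
  have hle : g i j * g i j ≤ 1 :=
    h ▸ Finset.single_le_sum (f := fun l ↦ g i l * g i l) (fun l _ ↦ mul_self_nonneg _)
      (Finset.mem_univ j)
  exact ⟨by nlinarith, by nlinarith⟩

instance compactSpace_orthogonalGroup : CompactSpace (Matrix.orthogonalGroup (Fin n) ℝ) :=
  isCompact_iff_compactSpace.1 isCompact_orthogonalGroup

instance isTopologicalGroup_orthogonalGroup :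
    IsTopologicalGroup (Matrix.orthogonalGroup (Fin n) ℝ) :=
  inferInstanceAs (IsTopologicalGroup (unitary (Matrix (Fin n) (Fin n) ℝ)))

instance borelSpace_orthogonalGroup : BorelSpace (Matrix.orthogonalGroup (Fin n) ℝ) :=
  Subtype.borelSpace _

instance borelSpace_SOGroup : BorelSpace (SOGroup n) :=
  Subtype.borelSpace _

lemma continuous_detHom : Continuous (detHom n) :=
  continuous_subtype_val.matrix_det

instance compactSpace_SOGroup : CompactSpace (SOGroup n) :=
  isCompact_iff_compactSpace.1 (isClosed_singleton.preimage continuous_detHom).isCompact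

/-- The Haar probability measure on `O(n)`. -/
def orthogonalHaar (n : ℕ) : Measure (Matrix.orthogonalGroup (Fin n) ℝ) :=
  Measure.haarMeasure ⊤

instance : (orthogonalHaar n).IsHaarMeasure :=
  inferInstanceAs (Measure.haarMeasure ⊤).IsHaarMeasure

instance : IsProbabilityMeasure (orthogonalHaar n) :=
  ⟨by simpa [orthogonalHaar] using Measure.haarMeasure_self (K₀ := (⊤ : TopologicalSpace.PositiveCompacts
    (Matrix.orthogonalGroup (Fin n) ℝ)))⟩

instance : (orthogonalHaar n).IsMulRightInvariant :=
  ⟨fun g ↦ by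
    have : IsProbabilityMeasure ((orthogonalHaar n).map (· * g)) :=
      Measure.isProbabilityMeasure_map (by fun_prop)
    exact Measure.isHaarMeasure_eq_of_isProbabilityMeasure _ _⟩

end Orthogonal

section General

variable {G H : Type*} [TopologicalSpace G] [CompactSpace G] [MeasurableSpace G] [BorelSpace G]
  [TopologicalSpace H] [CompactSpace H] [MeasurableSpace H] [BorelSpace H]

lemma Continuous.integrable_of_compactSpace (μ : Measure G) [IsFiniteMeasure μ] {f : G → ℝ}
    (hf : Continuous f) : Integrable f μ :=
  hf.integrable_of_hasCompactSupport (HasCompactSupport.of_compactSpace f)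

/-- Averaging over right translates does not change the integral against a right-invariant
measure. -/
lemma integral_eq_integral_integral_mul [Group G] [ContinuousMul G]
    (ν : Measure G) [IsProbabilityMeasure ν] [ν.IsMulRightInvariant]
    (μ : Measure H) [IsProbabilityMeasure μ] {φ : H → G} (hφ : Continuous φ) {f : G → ℝ}
    (hf : Continuous f) :
    ∫ g, f g ∂ν = ∫ g, ∫ h, f (g * φ h) ∂μ ∂ν := by
  rw [integral_integral_swap_of_hasCompactSupport (f := fun g h ↦ f (g * φ h))
    (by simp only [Function.uncurry_def]; fun_prop) (HasCompactSupport.of_compactSpace _)]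
  simp [integral_mul_right_eq_self]

lemma hasDerivAt_integral_of_continuous (μ : Measure G) [IsFiniteMeasure μ] {F F' : ℝ → G → ℝ}
    (hF : ∀ t, Continuous (F t)) (hF' : Continuous (Function.uncurry F'))
    (hd : ∀ t g, HasDerivAt (F · g) (F' t g) t) (t : ℝ) :
    HasDerivAt (fun s ↦ ∫ g, F s g ∂μ) (∫ g, F' t g ∂μ) t := by
  obtain ⟨C, hC⟩ := ((isCompact_closedBall t 1).prod isCompact_univ).exists_bound_of_continuousOn
    hF'.continuousOn
  refine (hasDerivAt_integral_of_dominated_loc_of_deriv_le (bound := fun _ ↦ C)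
    (Metric.closedBall_mem_nhds t one_pos) ?_ ((hF t).integrable_of_compactSpace μ) ?_ ?_
    (integrable_const _) ?_).2
  · exact .of_forall fun s ↦ ((hF s).integrable_of_compactSpace μ).aestronglyMeasurable
  · exact ((hF'.comp (by fun_prop : Continuous fun g : G ↦ (t, g))).integrable_of_compactSpace
      μ).aestronglyMeasurable
  · exact .of_forall fun g s hs ↦ hC (s, g) ⟨hs, Set.mem_univ _⟩
  · exact .of_forall fun g s _ ↦ hd s g

end General

section Blocks

variable {n : ℕ}

/-- The splitting of `Fin (n + 1)` into its first element and the others. -/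
def finSuccSum (n : ℕ) : Unit ⊕ Fin n ≃ Fin (n + 1) :=
  ((Equiv.sumComm _ _).trans (Equiv.optionEquivSumPUnit (Fin n)).symm).trans
    (finSuccEquiv n).symm

@[simp] lemma finSuccSum_inl (u : Unit) : finSuccSum n (Sum.inl u) = 0 := by
  simp [finSuccSum]

@[simp] lemma finSuccSum_inr (i : Fin n) : finSuccSum n (Sum.inr i) = i.succ := by
  simp [finSuccSum]

/-- The embedding `h ↦ 1 ⊕ h` of `O(n)` into `O(n + 1)`. -/
def orthogonalSucc (h : Matrix.orthogonalGroup (Fin n) ℝ) :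
    Matrix.orthogonalGroup (Fin (n + 1)) ℝ :=
  ⟨Matrix.reindex (finSuccSum n) (finSuccSum n) (Matrix.fromBlocks 1 0 0 h.1), by
    rw [Matrix.mem_orthogonalGroup_iff]
    have hh : h.1 * h.1ᵀ = 1 := (Matrix.mem_orthogonalGroup_iff _ _).1 h.2
    simp [Matrix.submatrix_mul_equiv, Matrix.fromBlocks_multiply,
      Matrix.fromBlocks_transpose, hh]⟩

lemma continuous_orthogonalSucc : Continuous (orthogonalSucc (n := n)) := by
  refine Continuous.subtype_mk (Continuous.matrix_reindex ?_ _ _) _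
  exact Continuous.matrix_fromBlocks continuous_const continuous_const continuous_const
    continuous_subtype_val

lemma det_one_sub_fromBlocks_mul_s14 {a : ℝ} (ha : a ≠ 1) (b : Matrix Unit (Fin n) ℝ)
    (c : Matrix (Fin n) Unit ℝ) (D h : Matrix (Fin n) (Fin n) ℝ) :
    Matrix.det (1 - Matrix.fromBlocks (a • 1) b c D * Matrix.fromBlocks 1 0 0 h) =
      (1 - a) * Matrix.det (1 - (D + (1 - a)⁻¹ • (c * b)) * h) := by
  have ha' : 1 - a ≠ 0 := sub_ne_zero.2 ha.symm
  have hM : (1 - Matrix.fromBlocks (a • 1) b c D * Matrix.fromBlocks 1 0 0 h) =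
      Matrix.fromBlocks ((1 - a) • 1) (-(b * h)) (-c) (1 - D * h) := by
    rw [← Matrix.fromBlocks_one, Matrix.fromBlocks_multiply, sub_eq_add_neg,
      Matrix.fromBlocks_neg, Matrix.fromBlocks_add]
    simp [sub_eq_add_neg, add_smul]
  let _ : Invertible ((1 - a) • (1 : Matrix Unit Unit ℝ)) :=
    ⟨(1 - a)⁻¹ • 1, by simp [smul_smul, ha'], by simp [smul_smul, ha']⟩
  have hinv : ⅟((1 - a) • (1 : Matrix Unit Unit ℝ)) = (1 - a)⁻¹ • 1 := rfl
  rw [hM, Matrix.det_fromBlocks₁₁, hinv]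
  congr 1
  · simp
  · congr 1
    simp [add_mul, Matrix.mul_assoc, sub_eq_add_neg, ← add_assoc, add_comm]

/-- Removing the first row and column: `det (1 - g (1 ⊕ h))` factors through `O(n)`. -/
lemma exists_det_one_sub_mul_orthogonalSucc (g : Matrix.orthogonalGroup (Fin (n + 1)) ℝ) :
    ∃ g' : Matrix.orthogonalGroup (Fin n) ℝ, ∀ h : Matrix.orthogonalGroup (Fin n) ℝ,
      Matrix.det (1 - (g * orthogonalSucc h).1) =
        (1 - g.1 0 0) * Matrix.det (1 - (g' * h).1) := by
  set e := finSuccSum n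
  set B := g.1.submatrix e e with hB
  have hBB : B * Bᵀ = 1 := by
    have := (Matrix.mem_orthogonalGroup_iff _ _).1 g.2
    rw [hB, Matrix.transpose_submatrix, Matrix.submatrix_mul_equiv, this,
      Matrix.submatrix_one_equiv]
  obtain ⟨a, ha⟩ : ∃ a, a = g.1 0 0 := ⟨_, rfl⟩
  obtain ⟨b, c, D, hfB⟩ : ∃ (b : Matrix Unit (Fin n) ℝ) (c : Matrix (Fin n) Unit ℝ)
      (D : Matrix (Fin n) (Fin n) ℝ), B = Matrix.fromBlocks (a • 1) b c D := by
    refine ⟨B.toBlocks₁₂, B.toBlocks₂₁, B.toBlocks₂₂, ?_⟩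
    conv_lhs => rw [← Matrix.fromBlocks_toBlocks B]
    congr 1
    ext i j
    simp [Matrix.toBlocks₁₁, hB, e, ha]
  have hdet (h : Matrix.orthogonalGroup (Fin n) ℝ) :
      Matrix.det (1 - (g * orthogonalSucc h).1) =
        Matrix.det (1 - Matrix.fromBlocks (a • 1) b c D * Matrix.fromBlocks 1 0 0 h.1) := by
    rw [← hfB, ← Matrix.det_submatrix_equiv_self e]
    congr 1
    rw [Matrix.submatrix_sub, Pi.sub_apply, Pi.sub_apply, Matrix.UnitaryGroup.mul_val, ← Matrix.submatrix_mul_equiv _ _ e e e]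
    simp [orthogonalSucc, hB, e]
  rw [hfB, Matrix.fromBlocks_transpose, Matrix.fromBlocks_multiply, ← Matrix.fromBlocks_one,
    Matrix.fromBlocks_inj] at hBB
  obtain ⟨h₁, -, h₂, h₃⟩ := hBB
  simp only [Matrix.transpose_smul, Matrix.transpose_one, Matrix.mul_smul, Matrix.mul_one,
    smul_smul] at h₁ h₂
  rw [← ha]
  by_cases ha1 : a = 1
  · refine ⟨1, fun h ↦ ?_⟩
    have hb : b = 0 := by
      rw [ha1] at h₁
      have : b * bᵀ = 0 := by simpa using h₁
      rw [← Matrix.conjTranspose_eq_transpose_of_trivial] at this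
      exact Matrix.self_mul_conjTranspose_eq_zero.1 this
    have hzero : Matrix.det
        (1 - Matrix.fromBlocks (a • 1) b c D * Matrix.fromBlocks 1 0 0 h.1) = 0 := by
      refine Matrix.det_eq_zero_of_row_eq_zero (Sum.inl ()) fun j ↦ ?_
      rw [Matrix.fromBlocks_multiply, ← Matrix.fromBlocks_one]
      cases j <;> simp [ha1, hb]
    rw [hdet, hzero, ha1]
    simp
  · have ha' : 1 - a ≠ 0 := sub_ne_zero.2 (Ne.symm ha1)
    refine ⟨⟨D + (1 - a)⁻¹ • (c * b), ?_⟩, fun h ↦ ?_⟩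
    · rw [Matrix.mem_orthogonalGroup_iff]
      have e₁ : b * bᵀ = (1 - a * a) • 1 := by
        rw [sub_smul, one_smul, eq_sub_of_add_eq' h₁]
      have e₂ : D * bᵀ = -(a • c) :=
        (neg_eq_of_add_eq_zero_right h₂).symm
      have e₃ : b * Dᵀ = -(a • cᵀ) := by
        have := congrArg Matrix.transpose e₂
        simpa using this
      have e₄ : D * Dᵀ = 1 - c * cᵀ := by rw [← h₃]; simp
      have e₅ : D * (bᵀ * cᵀ) = -(a • (c * cᵀ)) := by rw [← Matrix.mul_assoc, e₂]; simp
      have e₆ : b * (bᵀ * cᵀ) = (1 - a * a) • cᵀ := by rw [← Matrix.mul_assoc, e₁]; simp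
      simp only [Matrix.transpose_add, Matrix.transpose_smul, Matrix.transpose_mul, add_mul, mul_add,
        Matrix.smul_mul, Matrix.mul_smul, Matrix.mul_assoc, e₃, e₄, e₅, e₆, Matrix.mul_neg]
      ext i j
      simp
      field_simp
      ring
    · rw [hdet, det_one_sub_fromBlocks_mul_s14 ha1]
      rfl

end Blocks

section Moments

variable {n : ℕ}

/-- The `(i, j)` entry of an orthogonal matrix. -/
def entry (i j : Fin n) (g : Matrix.orthogonalGroup (Fin n) ℝ) : ℝ :=
  g.1 i j

@[fun_prop]
lemma continuous_entry (i j : Fin n) : Continuous (entry i j) :=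
  continuous_subtype_val.matrix_elem i j

lemma continuous_det_one_sub_pow (k : ℕ) :
    Continuous fun g : Matrix.orthogonalGroup (Fin n) ℝ ↦ Matrix.det (1 - g.1) ^ k :=
  ((continuous_const.sub continuous_subtype_val).matrix_det).pow k

/-- The `k`-th moment of `1 - x` for `x` a coordinate of a uniform point on the unit sphere of
`ℝ^(n+1)`. -/
def coordMoment (n k : ℕ) : ℝ :=
  ∫ g, (1 - entry 0 0 g) ^ k ∂orthogonalHaar (n + 1)

/-- The reflection in the hyperplane orthogonal to a unit vector. -/
def householder (w : Fin n → ℝ) (hw : w ⬝ᵥ w = 1) : Matrix.orthogonalGroup (Fin n) ℝ :=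
  ⟨1 - (2 : ℝ) • Matrix.vecMulVec w w, by
    rw [Matrix.mem_orthogonalGroup_iff]
    have h : Matrix.vecMulVec w w * Matrix.vecMulVec w w = Matrix.vecMulVec w w := by
      rw [Matrix.vecMulVec_mul_vecMulVec, hw, one_smul]
    simp only [Matrix.transpose_sub, Matrix.transpose_one, Matrix.transpose_smul,
      Matrix.transpose_vecMulVec, sub_mul, mul_sub, Matrix.mul_smul, Matrix.smul_mul, h, one_mul,
      mul_one, smul_smul]
    module⟩

lemma householder_mul_apply (w : Fin n → ℝ) (hw : w ⬝ᵥ w = 1)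
    (g : Matrix.orthogonalGroup (Fin n) ℝ) (i j : Fin n) :
    entry i j (householder w hw * g) = entry i j g - 2 * w i * ∑ l, w l * entry l j g := by
  rw [entry, Matrix.UnitaryGroup.mul_val, householder, Matrix.sub_mul, Matrix.one_mul,
    Matrix.smul_mul, Matrix.sub_apply, Matrix.smul_apply, Matrix.mul_apply]
  simp [Matrix.vecMulVec_apply, Finset.mul_sum, mul_assoc, entry]

/-- Integration by parts on the sphere along the rotations of a coordinate plane. -/
lemma integral_coord_mul_one_sub_pow (i : Fin n) (k : ℕ) :
    ∫ g, entry 0 0 g * (1 - entry 0 0 g) ^ (k + 1) ∂orthogonalHaar (n + 1) =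
      ∫ g, -((k + 1 : ℝ) * (entry i.succ 0 g ^ 2 * (1 - entry 0 0 g) ^ k)) ∂orthogonalHaar (n + 1) := by
  set ν := orthogonalHaar (n + 1)
  let u (t : ℝ) (g : Matrix.orthogonalGroup (Fin (n + 1)) ℝ) : ℝ :=
    Real.sin t * entry 0 0 g - Real.cos t * entry i.succ 0 g
  let u' (t : ℝ) (g : Matrix.orthogonalGroup (Fin (n + 1)) ℝ) : ℝ :=
    Real.cos t * entry 0 0 g + Real.sin t * entry i.succ 0 g
  let X (t : ℝ) (g : Matrix.orthogonalGroup (Fin (n + 1)) ℝ) : ℝ :=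
    entry 0 0 g - 2 * Real.sin t * u t g
  let Y (t : ℝ) (g : Matrix.orthogonalGroup (Fin (n + 1)) ℝ) : ℝ :=
    entry i.succ 0 g + 2 * Real.cos t * u t g
  let X' (t : ℝ) (g : Matrix.orthogonalGroup (Fin (n + 1)) ℝ) : ℝ :=
    -(2 * Real.cos t * u t g + 2 * Real.sin t * u' t g)
  let Y' (t : ℝ) (g : Matrix.orthogonalGroup (Fin (n + 1)) ℝ) : ℝ :=
    2 * -Real.sin t * u t g + 2 * Real.cos t * u' t g
  let F (t : ℝ) (g : Matrix.orthogonalGroup (Fin (n + 1)) ℝ) : ℝ := Y t g * (1 - X t g) ^ (k + 1)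
  let F' (t : ℝ) (g : Matrix.orthogonalGroup (Fin (n + 1)) ℝ) : ℝ :=
    Y' t g * (1 - X t g) ^ (k + 1) + Y t g * (((k + 1 : ℕ) : ℝ) * (1 - X t g) ^ k * -X' t g)
  have hinv (t : ℝ) : ∫ g, F t g ∂ν = ∫ g, entry i.succ 0 g * (1 - entry 0 0 g) ^ (k + 1) ∂ν := by
    let w : Fin (n + 1) → ℝ := Fin.cons (Real.sin t) (Pi.single i (-Real.cos t))
    have hw : w ⬝ᵥ w = 1 := by
      simp [w, dotProduct, Fin.sum_univ_succ, Pi.single_apply, ← sq]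
    rw [← integral_mul_left_eq_self (fun g ↦ entry i.succ 0 g * (1 - entry 0 0 g) ^ (k + 1))
      (householder w hw)]
    refine integral_congr_ae (.of_forall fun g ↦ ?_)
    have hs : ∑ l, w l * entry l 0 g = u t g := by
      simp [w, u, Fin.sum_univ_succ, Pi.single_apply, sub_eq_add_neg]
    simp only [householder_mul_apply, hs, F, X, Y]
    simp [w]
  have hu (t : ℝ) (g) : HasDerivAt (u · g) (u' t g) t := by
    have := ((Real.hasDerivAt_sin t).mul_const (entry 0 0 g)).sub
      ((Real.hasDerivAt_cos t).mul_const (entry i.succ 0 g))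
    exact this.congr_deriv (by simp [u'])
  have hX (t : ℝ) (g) : HasDerivAt (X · g) (X' t g) t :=
    (((Real.hasDerivAt_sin t).const_mul 2).mul (hu t g)).const_sub _
  have hY (t : ℝ) (g) : HasDerivAt (Y · g) (Y' t g) t :=
    (((Real.hasDerivAt_cos t).const_mul 2).mul (hu t g)).const_add _
  have hF (t : ℝ) (g) : HasDerivAt (F · g) (F' t g) t :=
    (hY t g).mul (((hX t g).const_sub 1).pow (k + 1))
  have hder := hasDerivAt_integral_of_continuous ν (F := F) (F' := F')
    (fun t ↦ by simp only [F, X, Y, u]; fun_prop)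
    (by simp only [Function.uncurry_def, F', X, Y, X', Y', u, u']; fun_prop) hF 0
  simp only [hinv] at hder
  have hzero := hder.unique (hasDerivAt_const _ _)
  have hF'0 : F' 0 = fun g ↦ 2 * (entry 0 0 g * (1 - entry 0 0 g) ^ (k + 1)) -
      2 * -((k + 1 : ℝ) * (entry i.succ 0 g ^ 2 * (1 - entry 0 0 g) ^ k)) := by
    funext g
    simp [F', X, Y, X', Y', u, u']
    ring
  rw [hF'0, integral_sub (Continuous.integrable_of_compactSpace ν (by fun_prop))
    (Continuous.integrable_of_compactSpace ν (by fun_prop)), integral_const_mul,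
    integral_const_mul] at hzero
  linarith

lemma coordMoment_succ (n k : ℕ) :
    (n + (k + 1) : ℝ) * coordMoment n (k + 2) = (n + 2 * (k + 1)) * coordMoment n (k + 1) := by
  set ν := orthogonalHaar (n + 1)
  have hI {f : Matrix.orthogonalGroup (Fin (n + 1)) ℝ → ℝ} (hf : Continuous f) :
    Integrable f ν := hf.integrable_of_compactSpace ν
  have hsum := Finset.sum_congr (s₁ := Finset.univ) rfl
    fun (i : Fin n) _ ↦ integral_coord_mul_one_sub_pow i k
  rw [← integral_finsetSum Finset.univ (f := fun (i : Fin n) g ↦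
    -((k + 1 : ℝ) * (entry i.succ 0 g ^ 2 * (1 - entry 0 0 g) ^ k)))
    fun i _ ↦ hI (by fun_prop)] at hsum
  have e₁ : ∫ g, entry 0 0 g * (1 - entry 0 0 g) ^ (k + 1) ∂ν =
      coordMoment n (k + 1) - coordMoment n (k + 2) := by
    rw [coordMoment, coordMoment, ← integral_sub (hI (by fun_prop)) (hI (by fun_prop))]
    congr with g
    ring
  have e₂ : ∫ g, ∑ i : Fin n, -((k + 1 : ℝ) * (entry i.succ 0 g ^ 2 * (1 - entry 0 0 g) ^ k)) ∂ν =
      -((k + 1) * (2 * coordMoment n (k + 1) - coordMoment n (k + 2))) := by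
    rw [coordMoment, coordMoment, ← integral_const_mul, ← integral_sub (hI (by fun_prop))
      (hI (by fun_prop)), ← integral_const_mul, ← integral_neg]
    congr with g
    have hg : entry 0 0 g ^ 2 + ∑ i : Fin n, entry i.succ 0 g ^ 2 = 1 := by
      have := congrFun (congrFun ((Matrix.mem_orthogonalGroup_iff' _ _).1 g.2) 0) 0
      simpa [entry, Matrix.mul_apply, Fin.sum_univ_succ, ← sq] using this
    rw [Finset.sum_neg_distrib, ← Finset.mul_sum, ← Finset.sum_mul, eq_sub_of_add_eq' hg]
    ring
  rw [e₂, e₁] at hsum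
  simp only [Finset.sum_const, Finset.card_univ, Fintype.card_fin, nsmul_eq_mul] at hsum
  linarith

lemma coordMoment_one (n : ℕ) : coordMoment n 1 = 1 := by
  have h : ∫ g, entry 0 0 g ∂orthogonalHaar (n + 1) = 0 := by
    have := integral_mul_left_eq_self (μ := orthogonalHaar (n + 1)) (entry 0 0) (-1)
    simp only [neg_mul, one_mul] at this
    have h2 : ∫ g, -entry 0 0 g ∂orthogonalHaar (n + 1) = ∫ g, entry 0 0 g ∂orthogonalHaar (n + 1) := this
    rw [integral_neg] at h2
    linarith
  simp only [coordMoment, pow_one]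
  rw [integral_sub (integrable_const _) ((continuous_entry 0 0).integrable_of_compactSpace _), h]
  simp

lemma integral_orthogonal_det_succ (n k : ℕ) :
    ∫ g, Matrix.det (1 - g.1) ^ k ∂orthogonalHaar (n + 1) =
      coordMoment n k * ∫ g, Matrix.det (1 - g.1) ^ k ∂orthogonalHaar n := by
  rw [integral_eq_integral_integral_mul (orthogonalHaar (n + 1)) (orthogonalHaar n)
    continuous_orthogonalSucc (continuous_det_one_sub_pow k), coordMoment, ← integral_mul_const]
  congr with g
  obtain ⟨g', hg'⟩ := exists_det_one_sub_mul_orthogonalSucc g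
  simp only [hg', mul_pow, integral_const_mul]
  congr 1
  exact integral_mul_left_eq_self (fun h : Matrix.orthogonalGroup (Fin n) ℝ ↦
    Matrix.det (1 - h.1) ^ k) g'

lemma integral_orthogonal_det_eq_prod (n k : ℕ) :
    ∫ g, Matrix.det (1 - g.1) ^ k ∂orthogonalHaar n = ∏ m ∈ Finset.range n, coordMoment m k := by
  induction n with
  | zero => simp
  | succ n ih => rw [integral_orthogonal_det_succ, ih, Finset.prod_range_succ, mul_comm]

lemma det_one_sub_eq_zero (N : ℕ) (g : Matrix.orthogonalGroup (Fin (2 * N)) ℝ)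
    (hg : g.1.det = -1) : Matrix.det (1 - g.1) = 0 := by
  have h : 1 - g.1 = g.1 * -(1 - g.1)ᵀ := by
    have := (Matrix.mem_orthogonalGroup_iff _ _).1 g.2
    simp [mul_sub, this]
  have h2 := congrArg Matrix.det h
  rw [Matrix.det_mul, hg, Matrix.det_neg, Matrix.det_transpose] at h2
  simp at h2
  linarith

lemma integral_orthogonal_det (n : ℕ) :
    ∫ g, g.1.det ∂orthogonalHaar (n + 1) = 0 := by
  let w : Fin (n + 1) → ℝ := Pi.single 0 1
  have hw : w ⬝ᵥ w = 1 := by simp [w]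
  have hdet : (householder w hw).1.det = -1 := by
    have : (householder w hw).1 = Matrix.diagonal (Fin.cons (-1) 1) := by
      ext i j
      refine Fin.cases ?_ (fun i ↦ ?_) i <;> refine Fin.cases ?_ (fun j ↦ ?_) j <;>
        simp [householder, w, Matrix.vecMulVec_apply, Matrix.one_apply, Matrix.diagonal_apply, (Fin.succ_ne_zero _).symm]
      norm_num
    rw [this, Matrix.det_diagonal]
    simp [Fin.prod_univ_succ]
  have := integral_mul_left_eq_self (μ := orthogonalHaar (n + 1)) (fun g ↦ g.1.det)
    (householder w hw)
  simp only [Matrix.UnitaryGroup.mul_val, Matrix.det_mul, hdet, integral_const_mul] at this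
  linarith

lemma orthogonal_det_eq_one_or (g : Matrix.orthogonalGroup (Fin n) ℝ) :
    g.1.det = 1 ∨ g.1.det = -1 := by
  have := congrArg Matrix.det ((Matrix.mem_orthogonalGroup_iff _ _).1 g.2)
  rw [Matrix.det_mul, Matrix.det_transpose, Matrix.det_one] at this
  exact mul_self_eq_one_iff.1 this

lemma integral_SO_eq_two_mul (N k : ℕ) (μ : Measure (SOGroup (2 * (N + 1)))) [μ.IsHaarMeasure]
    [IsProbabilityMeasure μ] :
    ∫ g, Matrix.det (1 - soMat g) ^ (k + 1) ∂μ =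
      2 * ∫ g, Matrix.det (1 - g.1) ^ (k + 1) ∂orthogonalHaar (2 * (N + 1)) := by
  rw [integral_eq_integral_integral_mul _ μ continuous_subtype_val (continuous_det_one_sub_pow _)]
  set c := ∫ g, Matrix.det (1 - soMat g) ^ (k + 1) ∂μ
  have h (g : Matrix.orthogonalGroup (Fin (2 * (N + 1))) ℝ) :
      ∫ h : SOGroup (2 * (N + 1)), Matrix.det (1 - (g * h).1) ^ (k + 1) ∂μ =
        (1 + g.1.det) * (c / 2) := by
    rcases orthogonal_det_eq_one_or g with hg | hg
    · have := integral_mul_left_eq_self (μ := μ) (fun h ↦ Matrix.det (1 - soMat h) ^ (k + 1))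
        (⟨g, hg⟩ : SOGroup (2 * (N + 1)))
      refine Eq.trans this ?_
      rw [hg]
      ring
    · have hz (h : SOGroup (2 * (N + 1))) : Matrix.det (1 - (g * h).1) = 0 := by
        refine det_one_sub_eq_zero _ _ ?_
        have hh : h.1.1.det = 1 := h.2
        simp [hg, hh]
      simp only [hz, hg]
      simp
  simp only [h]
  have hc : Continuous fun g : Matrix.orthogonalGroup (Fin (2 * (N + 1))) ℝ ↦ g.1.det :=
    continuous_detHom
  rw [integral_mul_const, integral_add (integrable_const _) (hc.integrable_of_compactSpace _),
    show 2 * (N + 1) = 2 * N + 1 + 1 by ring, integral_orthogonal_det]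
  simp
  ring

end Moments

section Gamma

lemma prod_coordMoment_succ (n k : ℕ) :
    (∏ m ∈ Finset.range n, (m + (k + 1) : ℝ)) * ∏ m ∈ Finset.range n, coordMoment m (k + 2) =
      (∏ m ∈ Finset.range n, (m + 2 * (k + 1) : ℝ)) *
        ∏ m ∈ Finset.range n, coordMoment m (k + 1) := by
  simp only [← Finset.prod_mul_distrib, coordMoment_succ]

/-- The right-hand side of the moment formula, as a function of `k`. -/
def gammaProd (N k : ℕ) : ℝ :=
  2 ^ (2 * N * k) *
    ∏ j ∈ Finset.Icc 1 N,
      (Real.Gamma ((N : ℝ) + (j : ℝ) - 1) * Real.Gamma ((k : ℝ) + (j : ℝ) - 1 / 2)) /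
        (Real.Gamma ((N : ℝ) + (k : ℝ) + (j : ℝ) - 1) * Real.Gamma ((j : ℝ) - 1 / 2))

lemma gammaProd_eq (N k : ℕ) :
    gammaProd N k = 2 ^ (2 * N * k) *
      ∏ j ∈ Finset.range N,
        (Real.Gamma ((N : ℝ) + j) * Real.Gamma ((k : ℝ) + j + 1 / 2)) /
          (Real.Gamma ((N : ℝ) + k + j) * Real.Gamma ((j : ℝ) + 1 / 2)) := by
  rw [gammaProd, show Finset.Icc 1 N = Finset.Ico 1 (N + 1) by ext; simp,
    Finset.prod_Ico_eq_prod_range, Nat.add_sub_cancel]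
  congr 1
  refine Finset.prod_congr rfl fun j _ ↦ ?_
  congr 3 <;> push_cast <;> ring

lemma gammaProd_zero {N : ℕ} (hN : 1 ≤ N) : gammaProd N 0 = 1 := by
  have hN' : (1 : ℝ) ≤ N := by exact_mod_cast hN
  rw [gammaProd_eq, Finset.prod_eq_one]
  · simp
  · intro j _
    have h₁ := (Real.Gamma_pos_of_pos (s := (N : ℝ) + j) (by positivity)).ne'
    have h₂ := (Real.Gamma_pos_of_pos (s := (j : ℝ) + 1 / 2) (by positivity)).ne'
    simp only [Nat.cast_zero, zero_add, add_zero]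
    field_simp

lemma gammaProd_succ {N : ℕ} (hN : 1 ≤ N) (k : ℕ) :
    (∏ j ∈ Finset.range N, ((N : ℝ) + k + j)) * gammaProd N (k + 1) =
      2 ^ (2 * N) * (∏ j ∈ Finset.range N, ((k : ℝ) + j + 1 / 2)) * gammaProd N k := by
  have hN' : (1 : ℝ) ≤ N := by exact_mod_cast hN
  have h : ∀ j ∈ Finset.range N, ((N : ℝ) + k + j) *
      ((Real.Gamma ((N : ℝ) + j) * Real.Gamma (((k + 1 : ℕ) : ℝ) + j + 1 / 2)) /
          (Real.Gamma ((N : ℝ) + (k + 1 : ℕ) + j) * Real.Gamma ((j : ℝ) + 1 / 2))) =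
      ((k : ℝ) + j + 1 / 2) *
      ((Real.Gamma ((N : ℝ) + j) * Real.Gamma ((k : ℝ) + j + 1 / 2)) /
          (Real.Gamma ((N : ℝ) + k + j) * Real.Gamma ((j : ℝ) + 1 / 2))) := by
    intro j _
    have p₁ : (N : ℝ) + k + j ≠ 0 := by positivity
    have p₂ : (k : ℝ) + j + 1 / 2 ≠ 0 := by positivity
    have h₁ := (Real.Gamma_pos_of_pos (s := (N : ℝ) + k + j) (by positivity)).ne'
    have h₂ := (Real.Gamma_pos_of_pos (s := (j : ℝ) + 1 / 2) (by positivity)).ne'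
    rw [show ((k + 1 : ℕ) : ℝ) + j + 1 / 2 = (k : ℝ) + j + 1 / 2 + 1 by push_cast; ring,
      show (N : ℝ) + (k + 1 : ℕ) + j = (N : ℝ) + k + j + 1 by push_cast; ring,
      Real.Gamma_add_one p₁, Real.Gamma_add_one p₂]
    generalize (k : ℝ) + j + 1 / 2 = x at *
    generalize (N : ℝ) + k + j = y at *
    field_simp
  have h' := Finset.prod_congr rfl h
  rw [Finset.prod_mul_distrib, Finset.prod_mul_distrib] at h'
  rw [gammaProd_eq, gammaProd_eq, mul_left_comm, h']
  ring

lemma prod_add_half_eq (N : ℕ) (x : ℝ) :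
    2 ^ (2 * N) * (∏ j ∈ Finset.range N, (x + j + 1 / 2)) * ∏ j ∈ Finset.range N, (x + j) =
      ∏ m ∈ Finset.range (2 * N), (m + 2 * x) := by
  induction N with
  | zero => simp
  | succ N ih =>
    rw [show 2 * (N + 1) = 2 * N + 1 + 1 by ring, Finset.prod_range_succ, Finset.prod_range_succ,
      Finset.prod_range_succ, Finset.prod_range_succ, ← ih]
    push_cast
    ring

lemma prod_add_eq (N : ℕ) (x : ℝ) :
    (∏ j ∈ Finset.range N, (N + x + j)) * ∏ j ∈ Finset.range N, (x + j) =
      ∏ m ∈ Finset.range (2 * N), (m + x) := by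
  rw [two_mul, Finset.prod_range_add, mul_comm]
  congr 1 <;> refine Finset.prod_congr rfl fun j _ ↦ ?_ <;> push_cast <;> ring

lemma two_pow_mul_prod_half (N : ℕ) :
    2 ^ (2 * (N + 1)) * ∏ j ∈ Finset.range (N + 1), ((j : ℝ) + 1 / 2) =
      2 * ∏ j ∈ Finset.range (N + 1), (((N + 1 : ℕ) : ℝ) + j) := by
  induction N with
  | zero => norm_num
  | succ N ih =>
    have h : (∏ j ∈ Finset.range (N + 1 + 1), (((N + 1 + 1 : ℕ) : ℝ) + j)) =
        2 * (2 * N + 3) * ∏ j ∈ Finset.range (N + 1), (((N + 1 : ℕ) : ℝ) + j) := by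
      rw [Finset.prod_range_succ, Finset.prod_range_succ, Finset.prod_range_succ' _ N]
      have : ∀ j : ℕ, ((N + 1 + 1 : ℕ) : ℝ) + j = ((N + 1 : ℕ) : ℝ) + (j + 1 : ℕ) := fun j ↦ by
        push_cast; ring
      simp only [this]
      push_cast
      ring
    rw [h, Finset.prod_range_succ]
    push_cast at ih ⊢
    linear_combination (4 * ((N : ℝ) + 1 + 1 / 2)) * ih

lemma gammaProd_one (N : ℕ) : gammaProd (N + 1) 1 = 2 := by
  have h := gammaProd_succ (Nat.le_add_left 1 N) 0
  simp only [Nat.cast_zero, add_zero, zero_add, gammaProd_zero (Nat.le_add_left 1 N), mul_one,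
    two_pow_mul_prod_half] at h
  have hpos : (∏ j ∈ Finset.range (N + 1), (((N + 1 : ℕ) : ℝ) + j)) ≠ 0 :=
    Finset.prod_ne_zero_iff.2 fun j _ ↦ by positivity
  exact mul_left_cancel₀ hpos (h.trans (mul_comm _ _))

lemma two_mul_prod_coordMoment (N k : ℕ) :
    2 * ∏ m ∈ Finset.range (2 * (N + 1)), coordMoment m (k + 1) = gammaProd (N + 1) (k + 1) := by
  induction k with
  | zero => simp [coordMoment_one, gammaProd_one]
  | succ k ih =>
    have h₁ := prod_coordMoment_succ (2 * (N + 1)) k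
    have h₂ := gammaProd_succ (Nat.le_add_left 1 N) (k + 1)
    have h₃ := prod_add_half_eq (N + 1) (k + 1)
    have h₄ := prod_add_eq (N + 1) (k + 1)
    have hpos : (∏ m ∈ Finset.range (2 * (N + 1)), ((m : ℝ) + (k + 1))) ≠ 0 :=
      Finset.prod_ne_zero_iff.2 fun j _ ↦ by positivity
    refine mul_left_cancel₀ hpos ?_
    rw [mul_left_comm, h₁, mul_left_comm, ih, ← h₄, ← h₃]
    push_cast at h₂ ⊢
    linear_combination (-∏ j ∈ Finset.range (N + 1), ((k : ℝ) + 1 + j)) * h₂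

end Gamma

/-- **Keating–Snaith moments for `SO(2N)`.** For integers `N ≥ 1` and `k ≥ 0`,
`∫_{SO(2N)} det(I − g)^k dg
  = 2^{2Nk} ∏_{j=1}^{N} (Γ(N+j−1) Γ(k+j−1/2)) / (Γ(N+k+j−1) Γ(j−1/2))`. -/
theorem moments_so_even (N k : ℕ) (hN : 1 ≤ N)
    (μ : Measure (SOGroup (2 * N))) [μ.IsHaarMeasure] [IsProbabilityMeasure μ] :
    (∫ g, Matrix.det (1 - soMat g) ^ k ∂μ)
      = 2 ^ (2 * N * k) *
        ∏ j ∈ Finset.Icc 1 N,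
          (Real.Gamma ((N : ℝ) + (j : ℝ) - 1) * Real.Gamma ((k : ℝ) + (j : ℝ) - 1 / 2)) /
            (Real.Gamma ((N : ℝ) + (k : ℝ) + (j : ℝ) - 1) * Real.Gamma ((j : ℝ) - 1 / 2)) := by
  rcases k with - | k
  · simpa [gammaProd] using (gammaProd_zero hN).symm
  obtain ⟨N, rfl⟩ := Nat.exists_eq_add_of_le' hN
  rw [integral_SO_eq_two_mul, integral_orthogonal_det_eq_prod, two_mul_prod_coordMoment, gammaProd]
end
end

section
/- Let K, L be natural numbers and let λ = (λ_1 ≥ λ_2 ≥ … ≥ λ_{L+K} ≥ 0) be a partition with at most L+K parts; write τ = (λ_1, …, λ_L) and ρ = (λ_{L+1}, …, λ_{L+K}), and let τ + ⟨K^L⟩ = (λ_1+K, …, λ_L+K). Let α_1, …, α_{L+K} be pairwise distinct complex numbers. Then s_λ(α_1, …, α_{L+K}) = ∑_{σ ∈ Ξ_{L,K}} ( ∏_{1 ≤ l ≤ L, 1 ≤ k ≤ K} (α_{σ(l)} − α_{σ(L+k)})^{-1} ) · s_{τ+⟨K^L⟩}(α_{σ(1)}, …, α_{σ(L)}) ·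 s_ρ(α_{σ(L+1)}, …, α_{σ(L+K)}). -/
open MeasureTheory Matrix Finset

noncomputable section

/-- The Schur polynomial `s_λ(a_1, …, a_n)` attached to a partition `λ` with at most `n`
parts, evaluated at `a_1, …, a_n`, as the ratio of the two determinants
`det(a_i^{λ_j + n - j}) / det(a_i^{n - j})` (with `1 ≤ j ≤ n`; here columns are
`0`-indexed, so the exponents read `λ_j + (n - 1 - j)` and `n - 1 - j`). -/
def schur {n : ℕ} (lam : Fin n → ℕ) (a : Fin n → ℂ) : ℂ :=
  Matrix.det (Matrix.of fun i j : Fin n => a i ^ (lam j + (n - 1 - (j : ℕ)))) /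
    Matrix.det (Matrix.of fun i j : Fin n => a i ^ (n - 1 - (j : ℕ)))

/-- The block permutation of `Fin (L + K)` acting by `p` on the first `L` indices and by `q` on
the last `K` indices. -/
def blockPerm {L K : ℕ} (p : Equiv.Perm (Fin L)) (q : Equiv.Perm (Fin K)) :
    Equiv.Perm (Fin (L + K)) :=
  finSumFinEquiv.permCongr (Equiv.Perm.sumCongr p q)

@[simp]
lemma blockPerm_castAdd {L K : ℕ} (p : Equiv.Perm (Fin L)) (q : Equiv.Perm (Fin K)) (i : Fin L) :
    blockPerm p q (Fin.castAdd K i) = Fin.castAdd K (p i) := by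
  simp [blockPerm, Equiv.permCongr_apply]

@[simp]
lemma blockPerm_natAdd {L K : ℕ} (p : Equiv.Perm (Fin L)) (q : Equiv.Perm (Fin K)) (i : Fin K) :
    blockPerm p q (Fin.natAdd L i) = Fin.natAdd L (q i) := by
  simp [blockPerm, Equiv.permCongr_apply]

lemma sign_blockPerm {L K : ℕ} (p : Equiv.Perm (Fin L)) (q : Equiv.Perm (Fin K)) :
    Equiv.Perm.sign (blockPerm p q) = Equiv.Perm.sign p * Equiv.Perm.sign q := by
  rw [blockPerm, Equiv.Perm.sign_permCongr, Equiv.Perm.sign_sumCongr]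

/-- The set `Ξ_{L,K}` of permutations increasing on the first `L` and on the last `K` indices. -/
def shuffles (L K : ℕ) : Finset (Equiv.Perm (Fin (L + K))) :=
  Finset.univ.filter fun σ =>
    (∀ i j : Fin L, i < j → σ (Fin.castAdd K i) < σ (Fin.castAdd K j)) ∧
    (∀ i j : Fin K, i < j → σ (Fin.natAdd L i) < σ (Fin.natAdd L j))

lemma mem_shuffles {L K : ℕ} {σ : Equiv.Perm (Fin (L + K))} :
    σ ∈ shuffles L K ↔
      StrictMono (fun i => σ (Fin.castAdd K i)) ∧ StrictMono (fun i => σ (Fin.natAdd L i)) := by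
  simp [shuffles, StrictMono]

lemma eq_of_mul_blockPerm_eq {L K : ℕ} {σ σ' : Equiv.Perm (Fin (L + K))}
    (hσ : σ ∈ shuffles L K) (hσ' : σ' ∈ shuffles L K)
    {p p' : Equiv.Perm (Fin L)} {q q' : Equiv.Perm (Fin K)}
    (h : σ * blockPerm p q = σ' * blockPerm p' q') : σ = σ' ∧ p = p' ∧ q = q' := by
  rw [mem_shuffles] at hσ hσ'
  have hp (i : Fin L) : σ (Fin.castAdd K (p i)) = σ' (Fin.castAdd K (p' i)) := by
    simpa using Equiv.congr_fun h (Fin.castAdd K i)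
  have hq (i : Fin K) : σ (Fin.natAdd L (q i)) = σ' (Fin.natAdd L (q' i)) := by
    simpa using Equiv.congr_fun h (Fin.natAdd L i)
  have hL : (fun i => σ (Fin.castAdd K i)) = fun i => σ' (Fin.castAdd K i) := by
    rw [← hσ.1.range_inj hσ'.1, ← p.surjective.range_comp fun i => σ (Fin.castAdd K i),
      ← p'.surjective.range_comp fun i => σ' (Fin.castAdd K i)]
    exact congrArg Set.range (funext hp)
  have hK : (fun i => σ (Fin.natAdd L i)) = fun i => σ' (Fin.natAdd L i) := by
    rw [← hσ.2.range_inj hσ'.2, ← q.surjective.range_comp fun i => σ (Fin.natAdd L i),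
      ← q'.surjective.range_comp fun i => σ' (Fin.natAdd L i)]
    exact congrArg Set.range (funext hq)
  have hσσ' : σ = σ' := Equiv.ext fun i =>
    Fin.addCases (fun i => congrFun hL i) (fun i => congrFun hK i) i
  subst hσσ'
  exact ⟨rfl, Equiv.ext fun i => Fin.castAdd_injective L K (σ.injective (hp i)),
    Equiv.ext fun i => Fin.natAdd_injective K L (σ.injective (hq i))⟩

lemma exists_mul_blockPerm_eq {L K : ℕ} (π : Equiv.Perm (Fin (L + K))) :
    ∃ σ ∈ shuffles L K, ∃ p q, σ * blockPerm p q = π := by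
  let s := Tuple.sort fun i => π (Fin.castAdd K i)
  let t := Tuple.sort fun i => π (Fin.natAdd L i)
  refine ⟨π * blockPerm s t, mem_shuffles.2 ⟨?_, ?_⟩, s⁻¹, t⁻¹, ?_⟩
  · refine Monotone.strictMono_of_injective ?_
      ((π * blockPerm s t).injective.comp (Fin.castAdd_injective L K))
    simpa [s, Function.comp_def] using Tuple.monotone_sort fun i => π (Fin.castAdd K i)
  · refine Monotone.strictMono_of_injective ?_
      ((π * blockPerm s t).injective.comp (Fin.natAdd_injective K L))
    simpa [t, Function.comp_def] using Tuple.monotone_sort fun i => π (Fin.natAdd L i)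
  · refine Equiv.ext fun i => Fin.addCases (fun i => ?_) (fun i => ?_) i <;> simp

/-- Laplace expansion of a determinant along its first `L` columns. -/
lemma det_eq_sum_shuffles {R : Type*} [CommRing R] {L K : ℕ}
    (M : Matrix (Fin (L + K)) (Fin (L + K)) R) :
    M.det = ∑ σ ∈ shuffles L K, ((Equiv.Perm.sign σ : ℤ) : R) *
      (M.submatrix (fun i => σ (Fin.castAdd K i)) (Fin.castAdd K)).det *
      (M.submatrix (fun i => σ (Fin.natAdd L i)) (Fin.natAdd L)).det := by
  have expand (σ : Equiv.Perm (Fin (L + K))) : ((Equiv.Perm.sign σ : ℤ) : R) *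
      (M.submatrix (fun i => σ (Fin.castAdd K i)) (Fin.castAdd K)).det *
      (M.submatrix (fun i => σ (Fin.natAdd L i)) (Fin.natAdd L)).det =
      ∑ x : Equiv.Perm (Fin L) × Equiv.Perm (Fin K),
        ((Equiv.Perm.sign (σ * blockPerm x.1 x.2) : ℤ) : R) *
          ∏ i, M ((σ * blockPerm x.1 x.2) i) i := by
    rw [Matrix.det_apply', Matrix.det_apply', mul_assoc, Finset.sum_mul_sum, Finset.mul_sum,
      Fintype.sum_prod_type]
    refine Finset.sum_congr rfl fun p _ => ?_
    rw [Finset.mul_sum]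
    refine Finset.sum_congr rfl fun q _ => ?_
    simp only [Equiv.Perm.sign_mul, sign_blockPerm, Fin.prod_univ_add, Equiv.Perm.mul_apply,
      blockPerm_castAdd, blockPerm_natAdd, Matrix.submatrix_apply, Units.val_mul, Int.cast_mul]
    ring
  simp_rw [expand]
  rw [Matrix.det_apply', ← Finset.sum_product']
  symm
  refine Finset.sum_bij (fun x _ => x.1 * blockPerm x.2.1 x.2.2) (fun _ _ => Finset.mem_univ _)
    ?_ ?_ (fun _ _ => rfl)
  · rintro ⟨σ, p, q⟩ hx ⟨σ', p', q'⟩ hx' h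
    obtain ⟨rfl, rfl, rfl⟩ :=
      eq_of_mul_blockPerm_eq (Finset.mem_product.1 hx).1 (Finset.mem_product.1 hx').1 h
    rfl
  · intro π _
    obtain ⟨σ, hσ, p, q, h⟩ := exists_mul_blockPerm_eq π
    exact ⟨(σ, p, q), Finset.mem_product.2 ⟨hσ, Finset.mem_univ _⟩, h⟩

/-- The Vandermonde determinant with decreasing exponents. -/
def vdm {n : ℕ} (a : Fin n → ℂ) : ℂ :=
  Matrix.det (Matrix.of fun i j : Fin n => a i ^ (n - 1 - (j : ℕ)))

lemma vdm_eq_prod {n : ℕ} (a : Fin n → ℂ) :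
    vdm a = ∏ i, ∏ j, if i < j then a i - a j else 1 := by
  have h : (Matrix.of fun i j : Fin n => a i ^ (n - 1 - (j : ℕ))) =
      Matrix.projVandermonde 1 a := by
    ext i j
    simp only [Matrix.of_apply, Matrix.projVandermonde_apply, Pi.one_apply, one_pow, one_mul,
      Fin.val_rev]
    congr 1
    omega
  rw [vdm, h, Matrix.det_projVandermonde]
  refine Finset.prod_congr rfl fun i _ => ?_
  rw [← Finset.prod_filter]
  refine Finset.prod_congr (by ext; simp) fun j _ => ?_
  simp

lemma vdm_ne_zero {n : ℕ} {a : Fin n → ℂ} (ha : Function.Injective a) : vdm a ≠ 0 := by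
  rw [vdm_eq_prod]
  refine Finset.prod_ne_zero_iff.2 fun i _ => Finset.prod_ne_zero_iff.2 fun j _ => ?_
  split_ifs with h
  · exact sub_ne_zero.2 (ha.ne h.ne)
  · exact one_ne_zero

lemma vdm_comp_perm {n : ℕ} (a : Fin n → ℂ) (σ : Equiv.Perm (Fin n)) :
    vdm (fun i => a (σ i)) = ((Equiv.Perm.sign σ : ℤ) : ℂ) * vdm a :=
  Matrix.det_permute σ (Matrix.of fun i j : Fin n => a i ^ (n - 1 - (j : ℕ)))

lemma vdm_add {L K : ℕ} (a : Fin (L + K) → ℂ) :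
    vdm a = (∏ l : Fin L, ∏ k : Fin K, (a (Fin.castAdd K l) - a (Fin.natAdd L k))) *
      vdm (fun l => a (Fin.castAdd K l)) * vdm (fun k => a (Fin.natAdd L k)) := by
  have hlt (l : Fin L) (k : Fin K) : Fin.castAdd K l < Fin.natAdd L k := by
    simp only [Fin.lt_def, Fin.val_castAdd, Fin.val_natAdd]
    omega
  simp only [vdm_eq_prod, Fin.prod_univ_add, hlt, (hlt _ _).not_gt, if_true, if_false,
    Finset.prod_const_one, Finset.prod_mul_distrib, Fin.natAdd_lt_natAdd_iff,
    (Fin.strictMono_castAdd K).lt_iff_lt]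
  ring

/-- **Laplace-expansion formula for Schur polynomials.** Let `λ` be a partition with at
most `L + K` parts, split as `τ = (λ_1, …, λ_L)` and `ρ = (λ_{L+1}, …, λ_{L+K})`, and
let `α_1, …, α_{L+K}` be pairwise distinct complex numbers. Then
`s_λ(α) = ∑_{σ ∈ Ξ_{L,K}} (∏_{l,k} (α_{σ(l)} − α_{σ(L+k)})⁻¹)
  · s_{τ+⟨K^L⟩}(α_{σ(1)}, …, α_{σ(L)}) · s_ρ(α_{σ(L+1)}, …, α_{σ(L+K)})`. -/
theorem schur_laplace_expansion (K L : ℕ) (lam : Fin (L + K) → ℕ)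
    (hlam : ∀ i j : Fin (L + K), i ≤ j → lam j ≤ lam i)
    (α : Fin (L + K) → ℂ) (hαinj : Function.Injective α) :
    schur lam α
      = ∑ σ ∈ Finset.univ.filter (fun σ : Equiv.Perm (Fin (L + K)) =>
            (∀ i j : Fin L, i < j → σ (Fin.castAdd K i) < σ (Fin.castAdd K j)) ∧
            (∀ i j : Fin K, i < j → σ (Fin.natAdd L i) < σ (Fin.natAdd L j))),
          (∏ l : Fin L, ∏ k : Fin K,
            (α (σ (Fin.castAdd K l)) - α (σ (Fin.natAdd L k)))⁻¹) *
          schur (fun l : Fin L => lam (Fin.castAdd K l) + K)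
            (fun l : Fin L => α (σ (Fin.castAdd K l))) *
          schur (fun j : Fin K => lam (Fin.natAdd L j))
            (fun j : Fin K => α (σ (Fin.natAdd L j))) := by
  change schur lam α = ∑ σ ∈ shuffles L K, _
  have hsplit := det_eq_sum_shuffles
    (Matrix.of fun i j : Fin (L + K) => α i ^ (lam j + (L + K - 1 - (j : ℕ))))
  rw [schur, hsplit, Finset.sum_div]
  refine Finset.sum_congr rfl fun σ _ => ?_
  have hτ : (Matrix.of fun i j : Fin (L + K) =>
      α i ^ (lam j + (L + K - 1 - (j : ℕ)))).submatrix
        (fun i => σ (Fin.castAdd K i)) (Fin.castAdd K) =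
      Matrix.of fun i j : Fin L =>
        α (σ (Fin.castAdd K i)) ^ (lam (Fin.castAdd K j) + K + (L - 1 - (j : ℕ))) := by
    ext i j
    simp only [Matrix.submatrix_apply, Matrix.of_apply, Fin.val_castAdd]
    congr 1
    omega
  have hρ : (Matrix.of fun i j : Fin (L + K) =>
      α i ^ (lam j + (L + K - 1 - (j : ℕ)))).submatrix
        (fun i => σ (Fin.natAdd L i)) (Fin.natAdd L) =
      Matrix.of fun i j : Fin K =>
        α (σ (Fin.natAdd L i)) ^ (lam (Fin.natAdd L j) + (K - 1 - (j : ℕ))) := by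
    ext i j
    simp only [Matrix.submatrix_apply, Matrix.of_apply, Fin.val_natAdd]
    congr 1
    omega
  rw [hτ, hρ, schur, schur]
  simp only [← vdm.eq_def, Finset.prod_inv_distrib]
  have hα := vdm_ne_zero hαinj
  have hασ := vdm_ne_zero (hαinj.comp σ.injective)
  have hadd := (vdm_comp_perm α σ).symm.trans (vdm_add fun i => α (σ i))
  have hsign : ((Equiv.Perm.sign σ : ℤ) : ℂ) * ((Equiv.Perm.sign σ : ℤ) : ℂ) = 1 := by
    rw [← Int.cast_mul, ← Units.val_mul, Int.units_mul_self, Units.val_one, Int.cast_one]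
  have hdiv : ((Equiv.Perm.sign σ : ℤ) : ℂ) / vdm α =
      (((Equiv.Perm.sign σ : ℤ) : ℂ) * vdm α)⁻¹ := by
    rw [mul_inv, ← eq_inv_of_mul_eq_one_left hsign, div_eq_mul_inv]
  rw [mul_assoc, mul_div_right_comm, hdiv, hadd, mul_inv, mul_inv]
  ring
end
end

section
/- Let k, N be natural numbers, let x_1, …, x_k be pairwise distinct complex numbers and t_1, …, t_N pairwise distinct complex numbers. Then ∏_{i=1}^{k} ∏_{n=1}^{N} (x_i − t_n) = ∑_{λ ⊆ ⟨N^k⟩} (−1)^{Nk − |λ|} · s_λ(x_1, …, x_k) · s_{λ̃}(t_1, …, t_N), where the sum is over all partitions λ with at most k parts, each part at most N, |λ| = ∑_i λ_i, and λ̃ is the partition (k − λ'_N, k − λ'_{N−1}, …, k − λ'_1) with λ'_j = #{i : λ_i ≥ j} the conjugate partition of λ. -/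
open MeasureTheory Matrix Finset

noncomputable section

/-- `conjP lam j = #{i : lam i ≥ j}`, the `j`-th part of the conjugate partition `λ'`. -/
def conjP {k : ℕ} (lam : Fin k → ℕ) (j : ℕ) : ℕ :=
  (Finset.univ.filter fun i : Fin k => j ≤ lam i).card

/-- The value of the rows-reversed Vandermonde determinant. -/
theorem det_pow_sub_one_sub {n : ℕ} (a : Fin n → ℂ) :
    Matrix.det (Matrix.of fun i j : Fin n => a i ^ (n - 1 - (j : ℕ))) =
      ∏ i : Fin n, ∏ j ∈ Ioi i, (a i - a j) := by
  have h := det_projVandermonde (fun _ => (1 : ℂ)) a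
  simp only [one_mul] at h
  rw [← h]
  congr 1
  ext i j
  simp [projVandermonde_apply, Fin.val_rev, Nat.sub_sub, add_comm]

theorem det_pow_sub_one_sub_ne_zero {n : ℕ} {a : Fin n → ℂ} (ha : Function.Injective a) :
    Matrix.det (Matrix.of fun i j : Fin n => a i ^ (n - 1 - (j : ℕ))) ≠ 0 := by
  rw [det_pow_sub_one_sub]
  refine prod_ne_zero_iff.2 fun i _ => prod_ne_zero_iff.2 fun j hj => ?_
  exact sub_ne_zero.2 fun h => (mem_Ioi.1 hj).ne (ha h)

theorem det_pow_sub_one_sub_append {k N : ℕ} (x : Fin k → ℂ) (t : Fin N → ℂ) :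
    Matrix.det (Matrix.of fun i j : Fin (k + N) =>
        (Fin.append x t) i ^ (k + N - 1 - (j : ℕ))) =
      Matrix.det (Matrix.of fun i j : Fin k => x i ^ (k - 1 - (j : ℕ))) *
        Matrix.det (Matrix.of fun i j : Fin N => t i ^ (N - 1 - (j : ℕ))) *
          ∏ i : Fin k, ∏ n : Fin N, (x i - t n) := by
  have hIoi : ∀ {n : ℕ} (i : Fin n) (f : Fin n → ℂ),
      ∏ j ∈ Ioi i, f j = ∏ j, if i < j then f j else 1 := by
    intro n i f
    rw [← prod_filter]
    congr 1
    ext j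
    simp
  have hlt (i : Fin k) (n : Fin N) : Fin.castAdd N i < Fin.natAdd k n := by
    simp only [Fin.lt_def, Fin.val_castAdd, Fin.val_natAdd]; omega
  simp only [det_pow_sub_one_sub, hIoi, Fin.prod_univ_add, Fin.append_left, Fin.append_right, hlt,
    (hlt _ _).not_gt, if_true, if_false, prod_const_one, prod_mul_distrib]
  simp only [Fin.lt_def, Fin.val_castAdd, Fin.val_natAdd, add_lt_add_iff_left]
  ring

theorem conjP_anti {k : ℕ} (lam : Fin k → ℕ) : Antitone (conjP lam) :=
  fun _ _ h => card_le_card fun _ => by simpa using h.trans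

theorem lt_conjP_iff {k : ℕ} {lam : Fin k → ℕ} (hlam : Antitone lam) (i : Fin k) (j : ℕ) :
    (i : ℕ) < conjP lam j ↔ j ≤ lam i := by
  constructor
  · intro h
    by_contra! hj
    have hsub : (univ.filter fun l : Fin k => j ≤ lam l) ⊆ Iio i := by
      intro l hl
      rw [mem_filter] at hl
      rw [mem_Iio]
      by_contra! hil
      exact absurd (hlam hil) (by omega)
    have := card_le_card hsub
    rw [Fin.card_Iio] at this
    exact absurd h (by unfold conjP; omega)
  · intro h
    have hsub : Iic i ⊆ (univ.filter fun l : Fin k => j ≤ lam l) := by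
      intro l hl
      simpa using h.trans (hlam (mem_Iic.1 hl))
    have := card_le_card hsub
    rw [Fin.card_Iic] at this
    exact this

theorem conjP_le {k : ℕ} (lam : Fin k → ℕ) (j : ℕ) : conjP lam j ≤ k :=
  (card_filter_le _ _).trans (by simp)

/-- The shuffle of `Fin (k + N)` attached to a partition in the `k × N` rectangle. -/
theorem exists_shuffle {k N : ℕ} {lam : Fin k → ℕ} (hlam : Antitone lam) :
    ∃ e : Equiv.Perm (Fin (k + N)),
      (∀ i, (e (Fin.castAdd N i) : ℕ) = i + (N - lam i)) ∧
      ∀ m, (e (Fin.natAdd k m) : ℕ) = m + conjP lam (N - m) := by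
  let f : Fin (k + N) → Fin (k + N) := Fin.addCases
    (fun i => ⟨i + (N - lam i), by omega⟩)
    (fun m => ⟨m + conjP lam (N - m), by have := conjP_le lam (N - m); omega⟩)
  have hf₁ (i : Fin k) : (f (Fin.castAdd N i) : ℕ) = i + (N - lam i) := by simp [f]
  have hf₂ (m : Fin N) : (f (Fin.natAdd k m) : ℕ) = m + conjP lam (N - m) := by simp [f]
  have hne (i : Fin k) (m : Fin N) : f (Fin.castAdd N i) ≠ f (Fin.natAdd k m) := by
    rw [Ne, Fin.ext_iff, hf₁, hf₂]
    have := lt_conjP_iff hlam i (N - m)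
    omega
  have hinj : Function.Injective f := by
    intro a b
    induction a using Fin.addCases with
    | left i =>
      induction b using Fin.addCases with
      | left j =>
        intro h
        rw [Fin.ext_iff, hf₁, hf₁] at h
        congr 1
        rcases le_total i j with hij | hij <;> have := hlam hij <;> rw [Fin.le_def] at hij <;>
          ext <;> omega
      | right m => exact fun h => (hne i m h).elim
    | right m =>
      induction b using Fin.addCases with
      | left j => exact fun h => (hne j m h.symm).elim
      | right l =>
        intro h
        rw [Fin.ext_iff, hf₂, hf₂] at h
        congr 1
        rcases le_total m l with hml | hml <;> rw [Fin.le_def] at hml <;>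
          have := conjP_anti lam (Nat.sub_le_sub_left hml N) <;> ext <;> omega
  exact ⟨Equiv.ofBijective f (Finite.injective_iff_bijective.1 hinj), hf₁, hf₂⟩

theorem sign_shuffle {k N : ℕ} {lam : Fin k → ℕ} (hlam : Antitone lam) (hN : ∀ i, lam i ≤ N)
    {e : Equiv.Perm (Fin (k + N))}
    (he₁ : ∀ i, (e (Fin.castAdd N i) : ℕ) = i + (N - lam i))
    (he₂ : ∀ m, (e (Fin.natAdd k m) : ℕ) = m + conjP lam (N - m)) :
    Equiv.Perm.sign e = (-1) ^ (N * k - ∑ i, lam i) := by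
  have hIio : ∀ {n : ℕ} (i : Fin n) (f : Fin n → ℤˣ),
      ∏ j ∈ Iio i, f j = ∏ j, if j < i then f j else 1 := by
    intro n i f
    rw [← prod_filter]
    congr 1
    ext j
    simp
  have hlt (i : Fin k) (n : Fin N) : Fin.castAdd N i < Fin.natAdd k n := by
    simp only [Fin.lt_def, Fin.val_castAdd, Fin.val_natAdd]; omega
  have h₁ (i j : Fin k) (h : i < j) : e (Fin.castAdd N i) < e (Fin.castAdd N j) := by
    have := hlam h.le
    rw [Fin.lt_def] at h ⊢
    rw [he₁, he₁]; omega
  have h₂ (i j : Fin N) (h : i < j) : e (Fin.natAdd k i) < e (Fin.natAdd k j) := by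
    rw [Fin.lt_def] at h ⊢
    have := conjP_anti lam (Nat.sub_le_sub_left h.le N)
    rw [he₂, he₂]; omega
  have h₃ (i : Fin k) (m : Fin N) :
      e (Fin.castAdd N i) < e (Fin.natAdd k m) ↔ N - m ≤ lam i := by
    rw [Fin.lt_def, he₁, he₂]
    have := lt_conjP_iff hlam i (N - m)
    omega
  have hcount (i : Fin k) :
      (∏ m : Fin N, if N - (m : ℕ) ≤ lam i then (1 : ℤˣ) else -1) = (-1) ^ (N - lam i) := by
    rw [prod_ite, prod_const_one, one_mul, prod_const]
    congr 1
    have := hN i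
    have hcard : #{m : Fin N | (m : ℕ) < N - lam i} = N - lam i := by
      rw [Fin.card_filter_val_lt]; omega
    rw [← hcard]
    congr 1
    ext m
    simp only [mem_filter, mem_univ, true_and]
    omega
  have hsum : N * k - ∑ i, lam i = ∑ i, (N - lam i) := by
    rw [sum_tsub_distrib _ fun i _ => hN i]
    simp [mul_comm]
  have hone₁ (i j : Fin k) : (if Fin.castAdd N j < Fin.castAdd N i then
      (if e (Fin.castAdd N j) < e (Fin.castAdd N i) then (1 : ℤˣ) else -1) else 1) = 1 := by
    split_ifs with h h'
    · rfl
    · exact absurd (h₁ _ _ h) h'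
    · rfl
  have hone₂ (i j : Fin N) : (if Fin.natAdd k j < Fin.natAdd k i then
      (if e (Fin.natAdd k j) < e (Fin.natAdd k i) then (1 : ℤˣ) else -1) else 1) = 1 := by
    split_ifs with h h'
    · rfl
    · exact absurd (h₂ _ _ (by simpa using h)) h'
    · rfl
  rw [Equiv.Perm.sign_eq_prod_prod_Iio]
  simp only [hIio, Fin.prod_univ_add, hlt, (hlt _ _).not_gt, if_true, if_false, hone₁, hone₂, h₃,
    prod_const_one, one_mul, mul_one]
  rw [prod_comm]
  simp only [hcount, prod_pow_eq_pow_sum, hsum]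

theorem StrictMono.add_sub_le_apply {k : ℕ} {g : Fin k → ℕ} (hg : StrictMono g) {i j : Fin k}
    (hij : i ≤ j) : g i + (j - i : ℕ) ≤ g j := by
  obtain ⟨j, hj⟩ := j
  induction j with
  | zero =>
    have : i = ⟨0, hj⟩ := le_antisymm hij (by simp [Fin.le_def])
    simp [this]
  | succ j ih =>
    rcases hij.eq_or_lt with rfl | hlt
    · simp
    · rw [Fin.lt_def] at hlt
      have h₁ := ih (by omega) (by rw [Fin.le_def]; simp at hlt ⊢; omega)
      have h₂ := hg (show (⟨j, by omega⟩ : Fin k) < ⟨j + 1, hj⟩ by simp [Fin.lt_def])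
      simp only at h₁ hlt ⊢
      omega

/-- Every `k`-subset of `Fin (k + N)` comes from a partition in the `k × N` rectangle. -/
theorem exists_partition_of_strictMono {k N : ℕ} {s : Fin k → Fin (k + N)} (hs : StrictMono s) :
    ∃ lam : Fin k → Fin (N + 1), Antitone lam ∧ ∀ i, (s i : ℕ) = i + (N - (lam i : ℕ)) := by
  have hg : StrictMono fun i => (s i : ℕ) := fun i j h => hs h
  have hlow (i : Fin k) : (i : ℕ) ≤ s i := by
    have := hg.add_sub_le_apply (i := ⟨0, i.pos⟩) (j := i) (by simp [Fin.le_def])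
    simp only at this
    omega
  have hup (i : Fin k) : (s i : ℕ) ≤ N + i := by
    have hi := i.2
    have := hg.add_sub_le_apply (i := i) (j := ⟨k - 1, by omega⟩)
      (by simp only [Fin.le_def]; omega)
    simp only at this
    omega
  refine ⟨fun i => ⟨N + i - s i, by have := hlow i; omega⟩, fun i j hij => ?_, fun i => ?_⟩
  · have := hg.add_sub_le_apply hij
    rw [Fin.le_def] at hij ⊢
    simp only at this ⊢
    omega
  · have := hlow i
    have := hup i
    simp only
    omega

/-- Laplace expansion along the first block of rows, the column sets being represented by a
transversal `e` of the permutations of `m ⊕ n` modulo those preserving both summands. -/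
theorem det_eq_sum_sign_mul_det_mul_det {m n ι R : Type*} [Fintype m] [DecidableEq m] [Fintype n]
    [DecidableEq n] [CommRing R] (P : Finset ι) (e : ι → Equiv.Perm (m ⊕ n))
    (hinj : ∀ a ∈ P, ∀ b ∈ P,
      Set.range (e a ∘ Sum.inl) = Set.range (e b ∘ Sum.inl) → a = b)
    (hsurj : ∀ σ : Equiv.Perm (m ⊕ n), ∃ a ∈ P,
      Set.range (σ ∘ Sum.inl) = Set.range (e a ∘ Sum.inl))
    (A : Matrix (m ⊕ n) (m ⊕ n) R) :
    A.det = ∑ a ∈ P, ((Equiv.Perm.sign (e a) : ℤ) : R) *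
      (Matrix.of fun i j => A (Sum.inl i) (e a (Sum.inl j))).det *
      (Matrix.of fun i j => A (Sum.inr i) (e a (Sum.inr j))).det := by
  have hterm (a : ι) : ((Equiv.Perm.sign (e a) : ℤ) : R) *
      (Matrix.of fun i j => A (Sum.inl i) (e a (Sum.inl j))).det *
      (Matrix.of fun i j => A (Sum.inr i) (e a (Sum.inr j))).det =
      ∑ p : Equiv.Perm m × Equiv.Perm n,
        ((Equiv.Perm.sign (e a * Equiv.Perm.sumCongr p.1 p.2) : ℤ) : R) *
          ∏ i, A i ((e a * Equiv.Perm.sumCongr p.1 p.2) i) := by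
    rw [← det_transpose, ← det_transpose (Matrix.of fun i j => A (Sum.inr i) (e a (Sum.inr j))),
      det_apply', det_apply', mul_assoc, Fintype.sum_mul_sum, ← Fintype.sum_prod_type', mul_sum]
    refine sum_congr rfl fun p _ => ?_
    simp only [Fintype.prod_sum_type, Equiv.Perm.sign_mul, Equiv.Perm.sign_sumCongr,
      Equiv.Perm.mul_apply, Equiv.Perm.sumCongr_apply, Sum.map_inl, Sum.map_inr, transpose_apply,
      of_apply]
    push_cast
    ring
  rw [sum_congr rfl fun a _ => hterm a, ← sum_product', ← det_transpose, det_apply']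
  symm
  have hrange (a : ι) (p : Equiv.Perm m × Equiv.Perm n) :
      Set.range ((e a * Equiv.Perm.sumCongr p.1 p.2 : Equiv.Perm (m ⊕ n)) ∘ Sum.inl) =
        Set.range (e a ∘ Sum.inl) := by
    have : (e a * Equiv.Perm.sumCongr p.1 p.2 : Equiv.Perm (m ⊕ n)) ∘ Sum.inl =
        (e a ∘ Sum.inl) ∘ p.1 := by
      ext i; simp
    rw [this, p.1.surjective.range_comp]
  refine sum_bij (fun q _ => e q.1 * Equiv.Perm.sumCongr q.2.1 q.2.2) (fun _ _ => mem_univ _)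
    ?_ ?_ (fun _ _ => by simp)
  · rintro ⟨a, p⟩ ha ⟨b, q⟩ hb h
    have hab : a = b := by
      refine hinj a (mem_product.1 ha).1 b (mem_product.1 hb).1 ?_
      rw [← hrange a p, ← hrange b q, h]
    subst hab
    rw [Prod.mk.injEq]
    exact ⟨rfl, Equiv.Perm.sumCongrHom_injective (mul_left_cancel h)⟩
  · intro σ _
    obtain ⟨a, ha, hσ⟩ := hsurj σ
    have hmaps : Set.MapsTo ((e a)⁻¹ * σ) (Set.range (Sum.inl : m → m ⊕ n))
        (Set.range (Sum.inl : m → m ⊕ n)) := by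
      rintro _ ⟨i, rfl⟩
      obtain ⟨j, hj⟩ : σ (Sum.inl i) ∈ Set.range (e a ∘ Sum.inl) := hσ ▸ ⟨i, rfl⟩
      exact ⟨j, by simp [← hj]⟩
    obtain ⟨p, hp⟩ := Equiv.Perm.mem_sumCongrHom_range_of_perm_mapsTo_inl hmaps
    refine ⟨(a, p), mem_product.2 ⟨ha, mem_univ _⟩, ?_⟩
    change e a * Equiv.Perm.sumCongrHom m n p = σ
    rw [hp, mul_inv_cancel_left]

/-- **Dual-Cauchy-type decomposition of `∏ (x_i − t_n)`.** For pairwise distinct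
`x_1, …, x_k` and pairwise distinct `t_1, …, t_N`,
`∏_{i,n} (x_i − t_n) = ∑_{λ ⊆ ⟨N^k⟩} (−1)^{Nk−|λ|} s_λ(x) s_{λ̃}(t)`,
summed over partitions `λ` with at most `k` parts, each at most `N` (encoded as
antitone functions `Fin k → Fin (N+1)`), where `λ̃ = (k − λ'_N, …, k − λ'_1)`. -/
theorem prod_diff_eq_sum_schur (k N : ℕ)
    (x : Fin k → ℂ) (hxinj : Function.Injective x)
    (t : Fin N → ℂ) (htinj : Function.Injective t) :
    (∏ i : Fin k, ∏ n : Fin N, (x i - t n))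
      = ∑ lam ∈ Finset.univ.filter
          (fun lam : Fin k → Fin (N + 1) => ∀ i j : Fin k, i ≤ j → lam j ≤ lam i),
          (-1 : ℂ) ^ (N * k - ∑ i : Fin k, (lam i : ℕ)) *
            schur (fun i : Fin k => (lam i : ℕ)) x *
            schur (fun m : Fin N => k - conjP (fun i : Fin k => (lam i : ℕ)) (N - (m : ℕ))) t := by
  set P := univ.filter
    (fun lam : Fin k → Fin (N + 1) => ∀ i j : Fin k, i ≤ j → lam j ≤ lam i) with hP
  have hanti {lam : Fin k → Fin (N + 1)} (h : lam ∈ P) : Antitone fun i => (lam i : ℕ) :=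
    fun i j hij => (mem_filter.1 h).2 i j hij
  have hex (lam : Fin k → Fin (N + 1)) : ∃ e : Equiv.Perm (Fin (k + N)), lam ∈ P →
      (∀ i, (e (Fin.castAdd N i) : ℕ) = i + (N - lam i)) ∧
      ∀ m, (e (Fin.natAdd k m) : ℕ) = m + conjP (fun i => (lam i : ℕ)) (N - m) := by
    by_cases h : lam ∈ P
    · obtain ⟨e, he⟩ := exists_shuffle (N := N) (hanti h)
      exact ⟨e, fun _ => he⟩
    · exact ⟨1, fun h' => (h h').elim⟩
  choose e he using hex
  have hmono {lam : Fin k → Fin (N + 1)} (h : lam ∈ P) :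
      StrictMono fun i => e lam (Fin.castAdd N i) := by
    intro i j hij
    have := hanti h hij.le
    rw [Fin.lt_def] at hij ⊢
    rw [(he lam h).1, (he lam h).1]
    simp only at this
    omega
  have hrange (σ : Equiv.Perm (Fin (k + N))) :
      Set.range (finSumFinEquiv.symm.permCongr σ ∘ Sum.inl) =
        finSumFinEquiv.symm '' Set.range fun i => σ (Fin.castAdd N i) := by
    rw [← Set.range_comp]
    congr 1
  have hlaplace := det_eq_sum_sign_mul_det_mul_det P
    (fun lam => finSumFinEquiv.symm.permCongr (e lam)) ?_ ?_
    ((Matrix.of fun i j : Fin (k + N) =>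
      (Fin.append x t) i ^ (k + N - 1 - (j : ℕ))).submatrix finSumFinEquiv finSumFinEquiv)
  · rw [det_submatrix_equiv_self, det_pow_sub_one_sub_append] at hlaplace
    have hx := det_pow_sub_one_sub_ne_zero hxinj
    have ht := det_pow_sub_one_sub_ne_zero htinj
    refine mul_left_cancel₀ (mul_ne_zero hx ht) ?_
    rw [hlaplace, mul_sum]
    refine sum_congr rfl fun lam hlam => ?_
    have hxdet : (Matrix.of fun i j : Fin k => x i ^ ((lam j : ℕ) + (k - 1 - (j : ℕ)))) =
        Matrix.of fun i j : Fin k => x i ^ (k + N - 1 - (e lam (Fin.castAdd N j) : ℕ)) := by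
      ext i j
      simp only [of_apply]
      rw [(he lam hlam).1]
      congr 1
      omega
    have htdet : (Matrix.of fun i j : Fin N => t i ^
          (k - conjP (fun i => (lam i : ℕ)) (N - (j : ℕ)) + (N - 1 - (j : ℕ)))) =
        Matrix.of fun i j : Fin N => t i ^ (k + N - 1 - (e lam (Fin.natAdd k j) : ℕ)) := by
      ext i j
      simp only [of_apply]
      rw [(he lam hlam).2]
      have := conjP_le (fun i => (lam i : ℕ)) (N - j)
      congr 1
      omega
    rw [Equiv.Perm.sign_permCongr, sign_shuffle (hanti hlam) (fun i => (lam i).is_le)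
      (he lam hlam).1 (he lam hlam).2, schur, schur, hxdet, htdet]
    simp only [submatrix_apply, of_apply, Equiv.permCongr_apply, Equiv.symm_symm,
      Equiv.apply_symm_apply, finSumFinEquiv_apply_left, finSumFinEquiv_apply_right,
      Fin.append_left, Fin.append_right]
    push_cast
    field_simp
  · intro a ha b hb hab
    rw [hrange, hrange, finSumFinEquiv.symm.injective.image_injective.eq_iff,
      (hmono ha).range_inj (hmono hb)] at hab
    ext i
    have h := congrArg Fin.val (congrFun hab i)
    simp only [(he a ha).1, (he b hb).1] at h
    omega
  · intro τ
    obtain ⟨σ, rfl⟩ := finSumFinEquiv.symm.permCongr.surjective τ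
    have hinj : Function.Injective fun i => σ (Fin.castAdd N i) :=
      σ.injective.comp (Fin.castAdd_injective k N)
    have hcard : #(univ.image fun i => σ (Fin.castAdd N i)) = k := by
      rw [card_image_of_injective _ hinj, card_univ, Fintype.card_fin]
    obtain ⟨lam, hlam, hs⟩ := exists_partition_of_strictMono (orderEmbOfFin _ hcard).strictMono
    have hmem : lam ∈ P := mem_filter.2 ⟨mem_univ _, fun i j hij => hlam hij⟩
    refine ⟨lam, hmem, ?_⟩
    have heq : (fun i => e lam (Fin.castAdd N i)) = orderEmbOfFin _ hcard := by
      ext i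
      rw [(he lam hmem).1, hs]
    rw [hrange, hrange, heq, range_orderEmbOfFin, coe_image, coe_univ, Set.image_univ]
end
end

section
/- Let N, k be natural numbers and let x_1, …, x_k be nonzero, pairwise distinct complex numbers with x_i x_j ≠ 1 for all 1 ≤ i ≤ j ≤ k. Then ∑_{λ} s_λ(x_1, …, x_k) = ∑_{ε ∈ {±1}^k} (∏_{j=1}^{k} x_j^{N(1−ε_j)}) · ∏_{1 ≤ i ≤ j ≤ k} (1 − x_i^{ε_i} x_j^{ε_j})^{-1}, where the left-hand sum is over all partitions λ with at most k parts, all parts even, and λ_1 ≤ 2N. -/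
open MeasureTheory Matrix Finset

noncomputable section

/-- The entries of a sign vector `ε ∈ {±1}^k`, encoded by a Boolean vector:
`sg ε j = 1` if `ε j = true` and `sg ε j = -1` otherwise. -/
def sg {k : ℕ} (ε : Fin k → Bool) (j : Fin k) : ℤ := if ε j then 1 else -1

/-- The product of `f` over all pairs `i < j`, with the pairs involving `p` split off. -/
lemma prod_prod_Ioi_succAbove {M : Type*} [CommMonoid M] {k : ℕ} (p : Fin (k + 1))
    (f : Fin (k + 1) → Fin (k + 1) → M) :
    ∏ i, ∏ j ∈ Ioi i, f i j =
      (∏ j, if p.succAbove j < p then f (p.succAbove j) p else f p (p.succAbove j)) *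
        ∏ i, ∏ j ∈ Ioi i, f (p.succAbove i) (p.succAbove j) := by
  have h (n : ℕ) (g : Fin n → Fin n → M) :
      ∏ i, ∏ j ∈ Ioi i, g i j = ∏ i, ∏ j, if i < j then g i j else 1 := by
    refine prod_congr rfl fun i _ => ?_
    rw [← prod_filter]
    congr 1
    ext j
    simp
  have h' (i : Fin (k + 1)) (g : Fin (k + 1) → M) :
      (∏ j, if i < j then g j else 1) = (if i < p then g p else 1) *
        ∏ j, if i < p.succAbove j then g (p.succAbove j) else 1 :=
    Fin.prod_univ_succAbove _ p
  simp only [h, h', Fin.prod_univ_succAbove _ p, prod_mul_distrib, lt_self_iff_false, if_false,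
    one_mul, Fin.succAbove_lt_succAbove_iff]
  rw [← mul_assoc, ← prod_mul_distrib]
  congr 1
  refine prod_congr rfl fun j _ => ?_
  rcases lt_or_gt_of_ne (Fin.succAbove_ne p j) with hj | hj
  · simp [hj, hj.not_gt]
  · simp [hj, hj.not_gt]

lemma prod_prod_Ici_eq_mul {M : Type*} [CommMonoid M] {k : ℕ} (f : Fin k → Fin k → M) :
    ∏ i, ∏ j ∈ Ici i, f i j = (∏ i, f i i) * ∏ i, ∏ j ∈ Ioi i, f i j := by
  simp only [← mul_prod_Ioi_eq_prod_Ici, prod_mul_distrib]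

/-- The product of a symmetric `f` over all pairs `i ≤ j`, with the pairs involving `p`
split off. -/
lemma prod_prod_Ici_succAbove {M : Type*} [CommMonoid M] {k : ℕ} (p : Fin (k + 1))
    (f : Fin (k + 1) → Fin (k + 1) → M) (hf : ∀ i j, f i j = f j i) :
    ∏ i, ∏ j ∈ Ici i, f i j =
      (∏ j, f p j) * ∏ i, ∏ j ∈ Ici i, f (p.succAbove i) (p.succAbove j) := by
  rw [prod_prod_Ici_eq_mul, prod_prod_Ici_eq_mul, prod_prod_Ioi_succAbove p,
    Fin.prod_univ_succAbove _ p, Fin.prod_univ_succAbove _ p]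
  simp only [hf _ p, ite_self, mul_assoc, mul_left_comm]

lemma prod_ite_succAbove_lt {k : ℕ} (p : Fin (k + 1)) :
    ∏ j : Fin k, (if p.succAbove j < p then (-1 : ℂ) else 1) = (-1) ^ (p : ℕ) := by
  simp only [Fin.succAbove_lt_iff_castSucc_lt, prod_ite, prod_const, one_pow, mul_one]
  simp only [Fin.lt_def, Fin.val_castSucc, Fin.card_filter_val_lt, min_eq_right p.is_le]

/-- The product `∏_{i < j} (x_i - x_j)`. -/
def diffProd {k : ℕ} (x : Fin k → ℂ) : ℂ := ∏ i, ∏ j ∈ Ioi i, (x i - x j)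

lemma diffProd_ne_zero {k : ℕ} {x : Fin k → ℂ} (hx : Function.Injective x) : diffProd x ≠ 0 :=
  prod_ne_zero_iff.2 fun _ _ => prod_ne_zero_iff.2 fun _ hj =>
    sub_ne_zero.2 (hx.ne (mem_Ioi.1 hj).ne)

lemma det_pow_rev_eq_diffProd {k : ℕ} (x : Fin k → ℂ) :
    Matrix.det (Matrix.of fun i j : Fin k => x i ^ (k - 1 - (j : ℕ))) = diffProd x := by
  have h : (Matrix.of fun i j : Fin k => x i ^ (k - 1 - (j : ℕ))) =
      Matrix.projVandermonde (fun _ => 1) x := by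
    ext i j
    rw [Matrix.projVandermonde_apply, Matrix.of_apply, one_pow, one_mul, Fin.val_rev]
    congr 1
    lia
  rw [h, Matrix.det_projVandermonde]
  simp [diffProd]

lemma diffProd_succAbove {k : ℕ} (p : Fin (k + 1)) (x : Fin (k + 1) → ℂ) :
    diffProd x = (-1) ^ (p : ℕ) * (∏ j, (x p - x (p.succAbove j))) *
      diffProd (fun j => x (p.succAbove j)) := by
  rw [diffProd, prod_prod_Ioi_succAbove p (fun i j => x i - x j), ← prod_ite_succAbove_lt p,
    diffProd]
  congr 1
  rw [← prod_mul_distrib]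
  refine prod_congr rfl fun j _ => ?_
  split_ifs <;> ring

/-- Evaluation at `0` of the interpolation of the degree `< #S` polynomial
`∏_{j ∈ S} (z - 1 / x_j) - ∏_{j ∈ S} (z - x_j)` at the nodes `x_j`. -/
lemma sum_prod_sub_inv_div {ι : Type*} [DecidableEq ι] (S : Finset ι) (x : ι → ℂ)
    (hx0 : ∀ i, x i ≠ 0) (hx : Function.Injective x) :
    ∑ i ∈ S, (1 - (x i)⁻¹ ^ 2) * ∏ j ∈ S.erase i, ((x i - (x j)⁻¹) / (x i - x j)) =
      1 - ∏ j ∈ S, (x j)⁻¹ ^ 2 := by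
  set f : Polynomial ℂ := Lagrange.nodal S (fun j => (x j)⁻¹) - Lagrange.nodal S x with hf
  have hdeg : f.degree < #S := by
    rw [← Lagrange.degree_nodal (s := S) (v := x)]
    refine Polynomial.degree_sub_lt_right ?_ Lagrange.nodal_ne_zero ?_
    · simp only [Lagrange.degree_nodal]
    · rw [Lagrange.nodal_monic.leadingCoeff, Lagrange.nodal_monic.leadingCoeff]
  have h := congrArg (Polynomial.eval 0) (Lagrange.eq_interpolate hx.injOn hdeg)
  have hD : ∏ j ∈ S, (0 - x j) ≠ 0 := prod_ne_zero_iff.2 fun j _ => by simpa using hx0 j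
  have hquot : ∏ j ∈ S, (0 - (x j)⁻¹) = (∏ j ∈ S, (0 - x j)) * ∏ j ∈ S, (x j)⁻¹ ^ 2 := by
    rw [← prod_mul_distrib]
    refine prod_congr rfl fun j _ => ?_
    have := hx0 j
    field_simp
    ring
  rw [Lagrange.interpolate_apply, Polynomial.eval_finsetSum, hf, Polynomial.eval_sub,
    Lagrange.eval_nodal, Lagrange.eval_nodal, hquot] at h
  apply mul_left_cancel₀ hD
  rw [mul_sub, mul_one, ← neg_sub, h, mul_sum, ← sum_neg_distrib]
  refine sum_congr rfl fun i hi => ?_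
  rw [Polynomial.eval_mul, Polynomial.eval_C, Polynomial.eval_sub, Lagrange.eval_nodal_at_node hi,
    sub_zero, Lagrange.eval_nodal, Lagrange.basis, Polynomial.eval_prod, ← mul_prod_erase _ _ hi,
    ← mul_prod_erase _ _ hi]
  have hi0 := hx0 i
  have hb : ∀ j, Polynomial.eval 0 (Lagrange.basisDivisor (x i) (x j)) =
      (0 - x j) / (x i - x j) := fun j => by
    simp [Lagrange.basisDivisor, div_eq_mul_inv, mul_comm]
  simp only [hb, prod_div_distrib]
  field_simp
  ring

/-- The summand `∏_{i ≤ j} (1 - x_i^{ε_i} x_j^{ε_j})⁻¹` attached to a sign vector. -/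
def signProd {k : ℕ} (x : Fin k → ℂ) (ε : Fin k → Bool) : ℂ :=
  ∏ i, ∏ j ∈ Ici i, (1 - x i ^ sg ε i * x j ^ sg ε j)⁻¹

/-- The sum over sign vectors with an arbitrary integer exponent `N`. -/
def signSum {k : ℕ} (N : ℤ) (x : Fin k → ℂ) : ℂ :=
  ∑ ε : Fin k → Bool, (∏ j, x j ^ (N * (1 - sg ε j))) * signProd x ε

lemma one_sub_zpow_mul_zpow_ne_zero {k : ℕ} {x : Fin k → ℂ} (hx0 : ∀ i, x i ≠ 0)
    (hx : Function.Injective x) (hx1 : ∀ i j, x i * x j ≠ 1) (ε : Fin k → Bool) (i j : Fin k) :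
    1 - x i ^ sg ε i * x j ^ sg ε j ≠ 0 := by
  have hi := hx0 i
  have hj := hx0 j
  have hij := hx1 i j
  rw [sub_ne_zero]
  by_cases h : i = j
  · subst h
    cases hε : ε i <;> simp only [sg, hε] <;> simp <;> field_simp <;> grind
  · have hne := hx.ne h
    cases hε : ε i <;> cases hε' : ε j <;> simp only [sg, hε, hε'] <;> simp <;> field_simp <;> grind

lemma signSum_neg_one {k : ℕ} {x : Fin (k + 1) → ℂ} (hx0 : ∀ i, x i ≠ 0)
    (hx : Function.Injective x) (hx1 : ∀ i j, x i * x j ≠ 1) : signSum (-1) x = 0 := by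
  set u : (Fin (k + 1) → Bool) → Fin (k + 1) → ℂ := fun ε i => (x i ^ sg ε i)⁻¹ with hu
  set C : ℂ := (∏ i, (1 - x i ^ 2)⁻¹) *
    ∏ i, ∏ j ∈ Ioi i, ((x j + (x j)⁻¹) - (x i + (x i)⁻¹))⁻¹ with hC
  have hterm (ε : Fin (k + 1) → Bool) :
      (∏ j, x j ^ ((-1 : ℤ) * (1 - sg ε j))) * signProd x ε =
        C * ((∏ i, (sg ε i : ℂ)) * Matrix.det (Matrix.vandermonde (u ε))) := by
    have hdiag : (∏ j, x j ^ ((-1 : ℤ) * (1 - sg ε j))) *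
        ∏ i, (1 - x i ^ sg ε i * x i ^ sg ε i)⁻¹ =
        (∏ i, (1 - x i ^ 2)⁻¹) * ∏ i, (sg ε i : ℂ) := by
      rw [← prod_mul_distrib, ← prod_mul_distrib]
      refine prod_congr rfl fun i _ => ?_
      have h0 := one_sub_zpow_mul_zpow_ne_zero hx0 hx hx1 ε i i
      have hi := hx0 i
      have h1 : 1 - x i ^ 2 ≠ 0 := by rw [sub_ne_zero, sq]; exact (hx1 i i).symm
      cases hε : ε i
      · simp only [sg, hε] at h0 ⊢
        have h2 : x i ^ 2 - 1 ≠ 0 := by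
          rw [← neg_sub]
          exact neg_ne_zero.2 h1
        have h3 : 1 - (x i)⁻¹ * (x i)⁻¹ = (x i ^ 2 - 1) / x i ^ 2 := by
          field_simp
        norm_num
        rw [h3, ← neg_sub (x i ^ 2) 1]
        field_simp
      · simp only [sg, hε]
        simp [sq]
    have hoff : ∏ i, ∏ j ∈ Ioi i, (1 - x i ^ sg ε i * x j ^ sg ε j)⁻¹ =
        (∏ i, ∏ j ∈ Ioi i, ((x j + (x j)⁻¹) - (x i + (x i)⁻¹))⁻¹) *
          ∏ i, ∏ j ∈ Ioi i, (u ε j - u ε i) := by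
      rw [← prod_mul_distrib]
      refine prod_congr rfl fun i _ => ?_
      rw [← prod_mul_distrib]
      refine prod_congr rfl fun j hj => ?_
      have hne := hx.ne (mem_Ioi.1 hj).ne
      have h0 := one_sub_zpow_mul_zpow_ne_zero hx0 hx hx1 ε i j
      have hi := hx0 i
      have hj := hx0 j
      have hij := hx1 i j
      have hw : (x j + (x j)⁻¹) - (x i + (x i)⁻¹) ≠ 0 := by
        have : (x j + (x j)⁻¹) - (x i + (x i)⁻¹) =
            (x i - x j) * (1 - x i * x j) * (x i)⁻¹ * (x j)⁻¹ := by
          field_simp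
          ring
        rw [this]
        simp [sub_eq_zero, hne, hi, hj, Ne.symm hij]
      rw [inv_mul_eq_div, eq_div_iff hw, inv_mul_eq_iff_eq_mul₀ h0]
      cases hε : ε i <;> cases hε' : ε j <;> simp only [hu, sg, hε, hε'] <;> simp <;>
        field_simp <;> ring
    rw [signProd, prod_prod_Ici_eq_mul, ← mul_assoc, hdiag, hoff, Matrix.det_vandermonde, hC]
    ring
  rw [signSum, sum_congr rfl fun ε _ => hterm ε, ← mul_sum]
  refine mul_eq_zero_of_right _ ?_
  simp only [Matrix.det_apply', Matrix.vandermonde_apply, mul_sum]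
  rw [sum_comm]
  refine sum_eq_zero fun σ _ => ?_
  have hσ (ε : Fin (k + 1) → Bool) :
      (∏ i, (sg ε i : ℂ)) * ((Equiv.Perm.sign σ : ℤ) * ∏ i, u ε (σ i) ^ (i : ℕ)) =
        (Equiv.Perm.sign σ : ℤ) *
          ∏ i, (if ε i then x i ^ (-(σ.symm i : ℤ)) else -x i ^ (σ.symm i : ℕ)) := by
    have hperm : ∏ i, u ε (σ i) ^ (i : ℕ) = ∏ i, u ε i ^ (σ.symm i : ℕ) := by
      rw [← Equiv.prod_comp σ (fun i => u ε i ^ (σ.symm i : ℕ))]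
      simp
    rw [hperm, mul_left_comm, ← prod_mul_distrib]
    congr 1
    refine prod_congr rfl fun i _ => ?_
    cases hε : ε i <;> simp [hu, sg, hε]
  rw [sum_congr rfl fun ε _ => hσ ε, ← mul_sum]
  refine mul_eq_zero_of_right _ ?_
  have := Finset.prod_univ_sum (fun _ : Fin (k + 1) => (univ : Finset Bool))
    (fun i b => (if b then x i ^ (-(σ.symm i : ℤ)) else -x i ^ (σ.symm i : ℕ)))
  rw [Fintype.piFinset_univ] at this
  rw [← this]
  refine prod_eq_zero (mem_univ (σ 0)) ?_
  simp

lemma signProd_succAbove {k : ℕ} (x : Fin (k + 1) → ℂ) (ε : Fin (k + 1) → Bool)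
    (p : Fin (k + 1)) :
    signProd x ε = (∏ j, (1 - x p ^ sg ε p * x j ^ sg ε j)⁻¹) *
      signProd (fun j => x (p.succAbove j)) (fun j => ε (p.succAbove j)) :=
  prod_prod_Ici_succAbove p (fun i j => (1 - x i ^ sg ε i * x j ^ sg ε j)⁻¹)
    fun i j => by rw [mul_comm]

/-- The coefficient of the `p`-th term when a variable is split off the Schur sum. -/
def splitCoeff {k : ℕ} (x : Fin (k + 1) → ℂ) (p : Fin (k + 1)) : ℂ :=
  ∏ j, (x p / (x p - x (p.succAbove j)))

lemma sum_splitCoeff_mul_signProd {k : ℕ} {x : Fin (k + 1) → ℂ} (hx0 : ∀ i, x i ≠ 0)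
    (hx : Function.Injective x) (hx1 : ∀ i j, x i * x j ≠ 1) (ε : Fin (k + 1) → Bool) :
    (∑ p, if ε p = false then splitCoeff x p *
        signProd (fun j => x (p.succAbove j)) (fun j => ε (p.succAbove j)) else 0) =
      (1 - ∏ j, if ε j = false then (x j)⁻¹ ^ 2 else 1) * signProd x ε := by
  rw [← sum_filter, ← prod_filter, ← sum_prod_sub_inv_div _ x hx0 hx, sum_mul]
  refine sum_congr rfl fun p hp => ?_
  have hp : ε p = false := by simpa using hp
  have hne : ∏ j, (1 - x p ^ sg ε p * x j ^ sg ε j) ≠ 0 :=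
    prod_ne_zero_iff.2 fun j _ => one_sub_zpow_mul_zpow_ne_zero hx0 hx hx1 ε p j
  have hkey : splitCoeff x p = (1 - (x p)⁻¹ ^ 2) *
      (∏ j ∈ (univ.filter fun j => ε j = false).erase p, ((x p - (x j)⁻¹) / (x p - x j))) *
        ∏ j, (1 - x p ^ sg ε p * x j ^ sg ε j)⁻¹ := by
    rw [prod_inv_distrib, eq_mul_inv_iff_mul_eq₀ hne, Fin.prod_univ_succAbove _ p, splitCoeff,
      mul_left_comm, ← prod_mul_distrib]
    congr 1
    · simp [sg, hp, sq]
    · have herase : (univ.filter fun j => ε j = false).erase p =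
          (univ.erase p).filter fun j => ε j = false := by
        rw [filter_erase]
      rw [herase, prod_filter, ← Finset.compl_singleton, ← Fin.image_succAbove_univ,
        prod_image (Fin.succAbove_right_injective.injOn)]
      refine prod_congr rfl fun j _ => ?_
      have hpj := sub_ne_zero.2 (hx.ne (Fin.succAbove_ne p j).symm)
      have h1 := hx0 p
      have h2 := hx0 (p.succAbove j)
      cases hε : ε (p.succAbove j) <;> simp [sg, hε, hp] <;> field_simp
  rw [signProd_succAbove x ε p, hkey, mul_assoc]

lemma signSum_sub_signSum {k : ℕ} {x : Fin (k + 1) → ℂ} (hx0 : ∀ i, x i ≠ 0)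
    (hx : Function.Injective x) (hx1 : ∀ i j, x i * x j ≠ 1) (N : ℤ) :
    signSum N x - signSum (N - 1) x =
      ∑ p, splitCoeff x p * x p ^ (2 * N) * signSum N (fun j => x (p.succAbove j)) := by
  have hlhs : signSum N x - signSum (N - 1) x = ∑ ε : Fin (k + 1) → Bool, ∑ p,
      if ε p = false then (∏ j, x j ^ (N * (1 - sg ε j))) * (splitCoeff x p *
        signProd (fun j => x (p.succAbove j)) (fun j => ε (p.succAbove j))) else 0 := by
    rw [signSum, signSum, ← sum_sub_distrib]
    refine sum_congr rfl fun ε _ => ?_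
    rw [sum_congr rfl fun p _ => (mul_ite_zero (ε p = false) _ _).symm, ← mul_sum,
      sum_splitCoeff_mul_signProd hx0 hx hx1, sub_mul, mul_sub, one_mul, ← mul_assoc,
      ← prod_mul_distrib]
    congr 2
    refine prod_congr rfl fun j _ => ?_
    have hj := hx0 j
    rw [sub_mul, one_mul, zpow_sub₀ hj, div_eq_mul_inv]
    congr 1
    cases hε : ε j <;> simp [sg, hε]
  rw [hlhs, sum_comm]
  refine sum_congr rfl fun p _ => ?_
  rw [← (Fin.insertNthEquiv (fun _ => Bool) p).sum_comp, Fintype.sum_prod_type, Fintype.sum_bool]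
  simp [Fin.insertNthEquiv, signSum, mul_sum, Fin.prod_univ_succAbove _ p, sg]
  refine sum_congr rfl fun ε _ => ?_
  ring_nf

lemma signSum_natCast {k : ℕ} {x : Fin (k + 1) → ℂ} (hx0 : ∀ i, x i ≠ 0)
    (hx : Function.Injective x) (hx1 : ∀ i j, x i * x j ≠ 1) (N : ℕ) :
    signSum N x = ∑ m ∈ range (N + 1), ∑ p,
      splitCoeff x p * x p ^ (2 * m) * signSum m (fun j => x (p.succAbove j)) := by
  induction N with
  | zero =>
    have h := signSum_sub_signSum hx0 hx hx1 0
    rw [zero_sub, signSum_neg_one hx0 hx hx1, sub_zero] at h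
    simpa using h
  | succ N ih =>
    have h := signSum_sub_signSum hx0 hx hx1 (N + 1)
    rw [add_sub_cancel_right, ih] at h
    rw [sum_range_succ, ← sub_eq_iff_eq_add']
    simpa using mod_cast h

lemma diffProd_mul_splitCoeff {k : ℕ} {x : Fin (k + 1) → ℂ} (hx : Function.Injective x)
    (p : Fin (k + 1)) :
    diffProd x * splitCoeff x p =
      (-1) ^ (p : ℕ) * x p ^ k * diffProd (fun j => x (p.succAbove j)) := by
  have h : ∏ j, (x p - x (p.succAbove j)) ≠ 0 :=
    prod_ne_zero_iff.2 fun j _ => sub_ne_zero.2 (hx.ne (Fin.succAbove_ne p j).symm)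
  rw [diffProd_succAbove p, splitCoeff, prod_div_distrib, prod_const, card_univ, Fintype.card_fin]
  field_simp

/-- Partitions with at most `k` parts, all at most `N`. -/
def boxPartitions (k N : ℕ) : Finset (Fin k → ℕ) :=
  (Fintype.piFinset fun _ => range (N + 1)).filter fun l => ∀ i j, i ≤ j → l j ≤ l i

lemma mem_boxPartitions {k N : ℕ} {l : Fin k → ℕ} :
    l ∈ boxPartitions k N ↔ (∀ i, l i ≤ N) ∧ ∀ i j, i ≤ j → l j ≤ l i := by
  simp [boxPartitions]

lemma sum_boxPartitions_succ {M : Type*} [AddCommMonoid M] {k N : ℕ} (f : (Fin (k + 1) → ℕ) → M) :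
    ∑ l ∈ boxPartitions (k + 1) N, f l =
      ∑ m ∈ range (N + 1), ∑ l ∈ boxPartitions k m, f (Fin.cons m l) := by
  rw [sum_sigma']
  refine sum_bij' (fun l _ => ⟨l 0, Fin.tail l⟩) (fun a _ => Fin.cons a.1 a.2) ?_ ?_ ?_ ?_ ?_
  · intro l hl
    rw [mem_boxPartitions] at hl
    simp only [mem_sigma, mem_range, Nat.lt_succ_iff, mem_boxPartitions, Fin.tail]
    exact ⟨hl.1 0, fun i => hl.2 _ _ (Fin.zero_le _), fun i j hij =>
      hl.2 _ _ (Fin.succ_le_succ_iff.2 hij)⟩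
  · rintro ⟨m, l⟩ hl
    simp only [mem_sigma, mem_range, Nat.lt_succ_iff, mem_boxPartitions] at hl
    obtain ⟨hm, hl1, hl2⟩ := hl
    rw [mem_boxPartitions]
    refine ⟨Fin.cases hm fun i => (hl1 i).trans hm, Fin.cases (Fin.cases ?_ ?_) fun i =>
      Fin.cases ?_ ?_⟩
    · simp
    · intro j _
      simpa using hl1 j
    · simp
    · intro j hij
      simpa using hl2 i j (Fin.succ_le_succ_iff.1 hij)
  · intro l _
    simp
  · rintro ⟨m, l⟩ _
    simp
  · intro l _
    simp

lemma sum_det_boxPartitions {k : ℕ} (N : ℕ) {x : Fin k → ℂ} (hx0 : ∀ i, x i ≠ 0)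
    (hx : Function.Injective x) (hx1 : ∀ i j, x i * x j ≠ 1) :
    ∑ l ∈ boxPartitions k N,
        Matrix.det (Matrix.of fun i j : Fin k => x i ^ (2 * l j + (k - 1 - (j : ℕ)))) =
      diffProd x * signSum N x := by
  induction k generalizing N with
  | zero =>
    have h : boxPartitions 0 N = univ := by
      ext l
      simpa [mem_boxPartitions] using Subsingleton.elim _ _
    simp [h, diffProd, signSum, signProd]
  | succ k ih =>
    rw [sum_boxPartitions_succ, signSum_natCast hx0 hx hx1, mul_sum]
    refine sum_congr rfl fun m _ => ?_
    simp only [Matrix.det_succ_column_zero]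
    rw [sum_comm, mul_sum]
    refine sum_congr rfl fun p _ => ?_
    rw [← mul_assoc, ← mul_assoc, diffProd_mul_splitCoeff hx, mul_right_comm _ (diffProd _),
      mul_assoc _ (diffProd _), ← ih m (fun j => hx0 _) (hx.comp Fin.succAbove_right_injective)
        (fun i j => hx1 _ _), mul_sum]
    refine sum_congr rfl fun l _ => ?_
    congr 1
    · simp only [Matrix.of_apply, Fin.cons_zero, Fin.val_zero]
      rw [mul_assoc, ← pow_add, add_comm k (2 * m), Nat.add_sub_cancel, Nat.sub_zero]
    · congr 1
      ext i j
      simp only [Matrix.submatrix_apply, Matrix.of_apply, Fin.cons_succ, Fin.val_succ]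
      congr 2
      lia

/-- **Okada–Krattenthaler identity.** For nonzero, pairwise distinct `x_1, …, x_k`
with `x_i x_j ≠ 1` for `i ≤ j`, the sum of `s_λ(x_1, …, x_k)` over all partitions `λ`
with at most `k` parts, all parts even and `λ_1 ≤ 2N` (encoded as antitone functions
`Fin k → Fin (2N+1)` with even values), equals
`∑_{ε ∈ {±1}^k} (∏_j x_j^{N(1−ε_j)}) ∏_{i ≤ j} (1 − x_i^{ε_i} x_j^{ε_j})⁻¹`. -/
theorem even_partition_schur_sum (N k : ℕ)
    (x : Fin k → ℂ) (hx0 : ∀ i, x i ≠ 0) (hxinj : Function.Injective x)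
    (hx1 : ∀ i j : Fin k, i ≤ j → x i * x j ≠ 1) :
    (∑ lam ∈ Finset.univ.filter
        (fun lam : Fin k → Fin (2 * N + 1) =>
          (∀ i j : Fin k, i ≤ j → lam j ≤ lam i) ∧ ∀ i : Fin k, Even (lam i : ℕ)),
        schur (fun i : Fin k => (lam i : ℕ)) x)
      = ∑ ε : Fin k → Bool,
          (∏ j : Fin k, x j ^ ((N : ℤ) * (1 - sg ε j))) *
          (∏ i : Fin k, ∏ j ∈ Finset.Ici i,
            (1 - x i ^ sg ε i * x j ^ sg ε j)⁻¹) := by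
  have hx1' : ∀ i j, x i * x j ≠ 1 := fun i j => by
    rcases le_total i j with h | h
    · exact hx1 i j h
    · rw [mul_comm]
      exact hx1 j i h
  have hsum := sum_det_boxPartitions N hx0 hxinj hx1'
  change _ = signSum N x
  rw [← mul_right_inj' (diffProd_ne_zero hxinj), ← hsum, mul_sum]
  refine sum_bij' (fun l _ i => (l i : ℕ) / 2)
    (fun l _ i => Fin.ofNat (2 * N + 1) (2 * l i)) ?_ ?_ ?_ ?_ ?_
  · intro l hl
    simp only [mem_filter, mem_univ, true_and] at hl
    rw [mem_boxPartitions]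
    refine ⟨fun i => by lia, fun i j hij => Nat.div_le_div_right (hl.1 i j hij)⟩
  · intro l hl
    rw [mem_boxPartitions] at hl
    have hmod : ∀ i, 2 * l i % (2 * N + 1) = 2 * l i := fun i =>
      Nat.mod_eq_of_lt (by have := hl.1 i; lia)
    simp only [mem_filter, mem_univ, true_and, Fin.le_def, Fin.ofNat, hmod]
    exact ⟨fun i j hij => Nat.mul_le_mul_left 2 (hl.2 i j hij), fun i => even_two_mul _⟩
  · intro l hl
    simp only [mem_filter, mem_univ, true_and] at hl
    ext i
    simp only [Fin.ofNat, Nat.two_mul_div_two_of_even (hl.2 i)]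
    exact Nat.mod_eq_of_lt (l i).2
  · intro l hl
    rw [mem_boxPartitions] at hl
    have hmod : ∀ i, 2 * l i % (2 * N + 1) = 2 * l i := fun i =>
      Nat.mod_eq_of_lt (by have := hl.1 i; lia)
    ext i
    simp [Fin.ofNat, hmod]
  · intro l hl
    simp only [mem_filter, mem_univ, true_and] at hl
    rw [schur, det_pow_rev_eq_diffProd, mul_div_cancel₀ _ (diffProd_ne_zero hxinj)]
    simp only [Nat.two_mul_div_two_of_even (hl.2 _)]
end
end
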